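/- Every connected graph that contains no induced subgraph isomorphic to a member of Ω_N is either a thread graph or a necklace graph whose underlying cycle has length at least 9. -/

import Mathlib

open scoped Classical

namespace LRW1

/-- The GF(2)-rank of the adjacency submatrix between `S` and its complement. -/
noncomputable def cutRank {V : Type} [Fintype V] (G : SimpleGraph V) (S : Set V) : ℕ :=
  Matrix.rank (Matrix.of fun (i : ↥S) (j : ↥(Sᶜ)) => if G.Adj i.1 j.1 then (1 : ZMod 2) else 0)

/-- `G` has linear rankwidth at most `k`: some linear ordering of the vertices in which
every prefix has cut-rank at most `k`. -/
def LinRankwidthLE {V : Type} [Fintype V] (G : SimpleGraph V) (k : ℕ) : Prop :=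
  ∃ σ : V ≃ Fin (Fintype.card V), ∀ i : ℕ, cutRank G {v : V | (σ v : ℕ) < i} ≤ k

/-- `B` is (the vertex set of) a thread block of `G` with first vertex `x` and last vertex `y`:
there is an ordering `σ` of `B` and a labeling (encoded by the predicates `lL`, `lR`,
"L ∈ ℓ(v)" and "R ∈ ℓ(v)") such that the first vertex is labelled `{R}`, the last `{L}`,
and for `v <_σ w`, `vw` is an edge iff `R ∈ ℓ(v)` and `L ∈ ℓ(w)`. -/
def IsThreadBlock {V : Type} (G : SimpleGraph V) (B : Finset V) (x y : V) : Prop :=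
  2 ≤ B.card ∧ x ∈ B ∧ y ∈ B ∧
  ∃ (σ : ↥B ≃ Fin B.card) (lL lR : V → Prop),
    (∀ v : ↥B, lL v.1 ∨ lR v.1) ∧
    (∀ hx : x ∈ B, (σ ⟨x, hx⟩ : ℕ) = 0) ∧ lR x ∧ ¬ lL x ∧
    (∀ hy : y ∈ B, (σ ⟨y, hy⟩ : ℕ) = B.card - 1) ∧ lL y ∧ ¬ lR y ∧
    (∀ v w : ↥B, (σ v : ℕ) < (σ w : ℕ) → (G.Adj v.1 w.1 ↔ (lR v.1 ∧ lL w.1)))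

/-- `G = P ⊙ 𝓑` for the directed path `P = v 0, v 1, …, v n` with `n` thread blocks `B i`
(for the arc from `v i` to `v (i+1)`), forming a mergeable family whose union is `G`. -/
def IsThreadDecomp {V : Type} (G : SimpleGraph V) (n : ℕ)
    (v : Fin (n+1) → V) (B : Fin n → Finset V) : Prop :=
  Function.Injective v ∧
  (∀ i : Fin n, IsThreadBlock G (B i) (v i.castSucc) (v i.succ)) ∧
  (∀ i j : Fin n, i ≠ j →
    ((B i : Set V) ∩ (B j : Set V)) =
      (({v i.castSucc, v i.succ} : Set V) ∩ ({v j.castSucc, v j.succ} : Set V))) ∧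
  (∀ a : V, ∃ i : Fin n, a ∈ B i) ∧
  (∀ a b : V, G.Adj a b → ∃ i : Fin n, a ∈ B i ∧ b ∈ B i)

/-- A (connected) thread graph: a single vertex, or `P ⊙ 𝓑` for a directed path `P`. -/
def IsThreadGraph {V : Type} [Fintype V] (G : SimpleGraph V) : Prop :=
  G.Connected ∧ (Fintype.card V ≤ 1 ∨
    ∃ (n : ℕ) (v : Fin (n+1) → V) (B : Fin n → Finset V), 1 ≤ n ∧ IsThreadDecomp G n v B)

/-- Cyclic successor on `Fin h`. -/
def cycSucc {h : ℕ} (i : Fin h) : Fin h := ⟨(i.1 + 1) % h, Nat.mod_lt _ i.pos⟩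

/-- `G = C ⊙ 𝓑` for the directed cycle `C` on `v 0, …, v (h-1)` with thread blocks `B i`
for the arcs `v i → v (i+1 mod h)`, forming a mergeable family whose union is `G`. -/
def IsNecklaceDecomp {V : Type} (G : SimpleGraph V) (h : ℕ)
    (v : Fin h → V) (B : Fin h → Finset V) : Prop :=
  3 ≤ h ∧ Function.Injective v ∧
  (∀ i : Fin h, IsThreadBlock G (B i) (v i) (v (cycSucc i))) ∧
  (∀ i j : Fin h, i ≠ j →
    ((B i : Set V) ∩ (B j : Set V)) =
      (({v i, v (cycSucc i)} : Set V) ∩ ({v j, v (cycSucc j)} : Set V))) ∧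
  (∀ a : V, ∃ i : Fin h, a ∈ B i) ∧
  (∀ a b : V, G.Adj a b → ∃ i : Fin h, a ∈ B i ∧ b ∈ B i)

/-- `f` linearly orders the vertices of `s` so that every prefix has cut-rank at most one. -/
def OrdOn {V : Type} (G : SimpleGraph V) (s : Set V) (f : V → ℤ) : Prop :=
  Set.InjOn f s ∧ ∀ a ∈ s, ∀ b ∈ s, ∀ c ∈ s, ∀ d ∈ s,
    f a < f c → f a < f d → f b < f c → f b < f d → G.Adj a c → G.Adj b d → G.Adj a d

/-- Every set of at most eight vertices has an ordering of cut-rank at most one. -/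
def Loc {V : Type} (G : SimpleGraph V) : Prop :=
  ∀ s : Set V, s.Finite → s.ncard ≤ 8 → ∃ f, OrdOn G s f

theorem minor_eq_of_rank_le_one {m n K : Type*} {_ : Fintype n} [Field K]
    (A : Matrix m n K) (hA : A.rank ≤ 1) (a b : m) (c d : n) :
    A a c * A b d = A a d * A b c := by
  by_contra hne
  have hdet : (A.submatrix ![a, b] ![c, d]).det ≠ 0 := by
    rw [Matrix.det_fin_two]
    simpa [sub_eq_zero] using hne
  have h1 := Matrix.rank_of_isUnit (A.submatrix ![a, b] ![c, d])
    ((Matrix.isUnit_iff_isUnit_det _).2 (isUnit_iff_ne_zero.2 hdet))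
  have h2 := Matrix.rank_submatrix_le A ![a, b] ![c, d]
  rw [Fintype.card_fin] at h1
  omega

theorem exists_ordOn_of_linRankwidthLE {V : Type} (G : SimpleGraph V) (s : Set V) [Fintype s]
    (h : LinRankwidthLE (G.induce s) 1) : ∃ f, OrdOn G s f := by
  obtain ⟨σ, hσ⟩ := h
  refine ⟨fun v => if hv : v ∈ s then ((σ ⟨v, hv⟩ : ℕ) : ℤ) else 0, ?_, ?_⟩
  · intro a ha b hb hab
    simp only [ha, hb, dif_pos, Nat.cast_inj] at hab
    simpa using σ.injective (Fin.ext hab)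
  · intro a ha b hb c hc d hd hac had hbc hbd h1 h2
    simp only [ha, hb, hc, hd, dif_pos, Nat.cast_lt] at hac had hbc hbd
    have := minor_eq_of_rank_le_one _
      (hσ (max (σ ⟨a, ha⟩ : ℕ) (σ ⟨b, hb⟩) + 1))
      ⟨⟨a, ha⟩, by simp⟩ ⟨⟨b, hb⟩, by simp⟩
      ⟨⟨c, hc⟩, by simp; omega⟩ ⟨⟨d, hd⟩, by simp; omega⟩
    simp only [SimpleGraph.comap_adj, Function.Embedding.subtype_apply, Matrix.of_apply, h1, h2,
      if_true] at this
    by_contra h3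
    simp [h3] at this

/-- The number with binary digits `l`, least significant first. -/
def ofDigits2 : List Bool → ℕ
  | [] => 0
  | b :: l => Nat.bit b (ofDigits2 l)

theorem testBit_ofDigits2 (l : List Bool) (i : ℕ) :
    (ofDigits2 l).testBit i = l.getD i false := by
  induction l generalizing i with
  | nil => simp [ofDigits2]
  | cons b l ih =>
    cases i with
    | zero => simp [ofDigits2]
    | succ i => simp [ofDigits2, Nat.testBit_bit_succ, ih]

/-- The cut between the complement of the bit set `T` and `T` has rank at most one, where
`rows i` is the bit set of neighbours of `i`. -/
def cutOK (n : ℕ) (rows : ℕ → ℕ) (T : ℕ) : Bool :=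
  match ((List.range n).map fun i => bif T.testBit i then 0 else rows i &&& T).filter
    fun x => !Nat.beq x 0 with
  | [] => true
  | x :: xs => xs.all (Nat.beq x)

/-- Search for an ordering whose prefixes all have cut-rank at most one; `T` is the bit set
of the vertices that are still to be placed. -/
def search (n : ℕ) (rows : ℕ → ℕ) : ℕ → ℕ → Bool
  | 0, _ => true
  | k + 1, T => cutOK n rows T &&
      (List.range n).any fun i => T.testBit i && search n rows k (T ^^^ 2 ^ i)

theorem cutOK_eq_true {n T : ℕ} {rows : ℕ → ℕ}
    (h : ∀ a < n, ∀ b < n, ∀ c, ∀ d, ¬ T.testBit a → ¬ T.testBit b → T.testBit c → T.testBit d →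
      (rows a).testBit c → (rows b).testBit d → (rows a).testBit d) :
    cutOK n rows T = true := by
  have key : ∀ x ∈ ((List.range n).map fun i => bif T.testBit i then 0 else rows i &&& T).filter
      fun x => !Nat.beq x 0, ∃ a < n, ¬ T.testBit a ∧ x = rows a &&& T ∧
        ∃ c, T.testBit c ∧ (rows a).testBit c := by
    intro x hx
    simp only [List.mem_filter, List.mem_map, List.mem_range] at hx
    obtain ⟨⟨a, ha, rfl⟩, hx0⟩ := hx
    by_cases hTa : T.testBit a = true
    · simp [hTa] at hx0
    · simp only [hTa, cond_false] at hx0 ⊢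
      have hne : rows a &&& T ≠ 0 := by
        intro h0; rw [h0] at hx0; simp at hx0
      obtain ⟨c, hc⟩ := Nat.exists_testBit_of_ne_zero hne
      rw [Nat.testBit_and, Bool.and_eq_true] at hc
      exact ⟨a, ha, hTa, rfl, c, hc.2, hc.1⟩
  have heq : ∀ a < n, ∀ b < n, ¬ T.testBit a → ¬ T.testBit b →
      (∃ c, T.testBit c ∧ (rows a).testBit c) → (∃ c, T.testBit c ∧ (rows b).testBit c) →
      rows a &&& T = rows b &&& T := by
    rintro a ha b hb hTa hTb ⟨c, hc, hc'⟩ ⟨d, hd, hd'⟩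
    apply Nat.eq_of_testBit_eq
    intro i
    rw [Nat.testBit_and, Nat.testBit_and, Bool.eq_iff_iff, Bool.and_eq_true, Bool.and_eq_true]
    constructor
    · rintro ⟨h1, h2⟩
      exact ⟨h b hb a ha d i hTb hTa hd h2 hd' h1, h2⟩
    · rintro ⟨h1, h2⟩
      exact ⟨h a ha b hb c i hTa hTb hc h2 hc' h1, h2⟩
  unfold cutOK
  split
  · rfl
  · rename_i x xs hxs
    rw [hxs] at key
    rw [List.all_eq_true]
    intro y hy
    obtain ⟨a, ha, hTa, rfl, hca⟩ := key x (by simp)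
    obtain ⟨b, hb, hTb, rfl, hcb⟩ := key y (by simp [hy])
    rw [heq a ha b hb hTa hTb hca hcb]
    simp

theorem search_eq_true {n : ℕ} {rows : ℕ → ℕ} {g : ℕ → ℤ}
    (hg : ∀ i < n, ∀ j < n, g i = g j → i = j)
    (h : ∀ a < n, ∀ b < n, ∀ c < n, ∀ d < n, g a < g c → g a < g d → g b < g c → g b < g d →
      (rows a).testBit c → (rows b).testBit d → (rows a).testBit d) :
    ∀ k T, (∀ i, T.testBit i → i < n) →
      (∀ i < n, ∀ j, ¬ T.testBit i → T.testBit j → g i < g j) →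
      k ≤ ((Finset.range n).filter fun i => T.testBit i).card → search n rows k T = true := by
  intro k
  induction k with
  | zero => intros; rfl
  | succ k ih =>
    intro T hT hdown hk
    rw [search, Bool.and_eq_true]
    refine ⟨cutOK_eq_true fun a ha b hb c d hTa hTb hc hd => ?_, ?_⟩
    · exact h a ha b hb c (hT c hc) d (hT d hd) (hdown a ha c hTa hc) (hdown a ha d hTa hd)
        (hdown b hb c hTb hc) (hdown b hb d hTb hd)
    · have hne : ((Finset.range n).filter fun i => T.testBit i).Nonempty :=
        Finset.card_pos.1 (by omega)
      obtain ⟨m, hm, hmin⟩ := Finset.exists_min_image _ g hne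
      simp only [Finset.mem_filter, Finset.mem_range, and_imp] at hm hmin
      have hbit : ∀ i, (T ^^^ 2 ^ m).testBit i = true ↔ T.testBit i = true ∧ i ≠ m := by
        intro i
        rw [Nat.testBit_xor, Nat.testBit_two_pow]
        by_cases him : m = i
        · subst him; simp [hm.2]
        · simp [him, Ne.symm him]
      rw [List.any_eq_true]
      refine ⟨m, by simpa using hm.1, ?_⟩
      rw [Bool.and_eq_true]
      refine ⟨hm.2, ih _ (fun i hi => hT i ((hbit i).1 hi).1) ?_ ?_⟩
      · intro i hi j hTi hTj
        rw [hbit] at hTi hTj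
        by_cases him : i = m
        · subst him
          have h1 := hmin j (hT j hTj.1) hTj.1
          rcases h1.lt_or_eq with h2 | h2
          · exact h2
          · exact absurd (hg _ hi _ (hT j hTj.1) h2).symm hTj.2
        · exact hdown i hi j (fun h' => hTi ⟨h', him⟩) hTj.1
      · have : ((Finset.range n).filter fun i => (T ^^^ 2 ^ m).testBit i)
            = ((Finset.range n).filter fun i => T.testBit i).erase m := by
          ext i
          simp only [Finset.mem_filter, Finset.mem_erase, hbit]
          tauto
        rw [this, Finset.card_erase_of_mem (by simpa using hm)]
        omega

/-- All ways to resolve the unknown entries (those other than `0` and `1`) of a row. -/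
def rowCompletions : List ℕ → List (List Bool)
  | [] => [[]]
  | 0 :: r => (rowCompletions r).map (false :: ·)
  | 1 :: r => (rowCompletions r).map (true :: ·)
  | _ :: r => (rowCompletions r).flatMap fun l => [false :: l, true :: l]

/-- All ways to resolve the unknown entries of a triangular pattern. -/
def completions : List (List ℕ) → List (List (List Bool))
  | [] => [[]]
  | r :: M => (rowCompletions r).flatMap fun l => (completions M).map (l :: ·)

/-- The adjacency given by a triangular list of rows; row `i` lists the adjacencies
to `i + 1, i + 2, …`. -/
def triAdj : List (List Bool) → ℕ → ℕ → Bool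
  | r :: _, 0, j + 1 => r.getD j false
  | r :: _, i + 1, 0 => r.getD i false
  | _ :: M, i + 1, j + 1 => triAdj M i j
  | _, _, _ => false

/-- No completion of the pattern has an ordering of cut-rank at most one. -/
def obstructs (M : List (List ℕ)) : Bool :=
  (completions M).all fun M' =>
    let rows := (List.range M.length).map fun i =>
      ofDigits2 ((List.range M.length).map (triAdj M' i))
    !search M.length (fun i => rows.getD i 0) M.length (2 ^ M.length - 1)

/-- The vertex `v` is distinct from the vertices in the list, with adjacencies prescribed by
the row (`0`: not adjacent, `1`: adjacent, other entries: not prescribed). -/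
def RowFits {V : Type} (G : SimpleGraph V) (v : V) : List V → List ℕ → Prop
  | [], [] => True
  | w :: l, 0 :: r => (v ≠ w ∧ ¬ G.Adj v w) ∧ RowFits G v l r
  | w :: l, 1 :: r => G.Adj v w ∧ RowFits G v l r
  | w :: l, _ :: r => v ≠ w ∧ RowFits G v l r
  | _, _ => False

/-- The vertices of the list induce a subgraph with the given triangular pattern. -/
def Fits {V : Type} (G : SimpleGraph V) : List V → List (List ℕ) → Prop
  | [], [] => True
  | v :: l, r :: M => RowFits G v l r ∧ Fits G l M
  | _, _ => False

theorem RowFits.spec {V : Type} {G : SimpleGraph V} {v : V} {l : List V} {r : List ℕ}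
    (h : RowFits G v l r) :
    v ∉ l ∧ l.map (fun w => decide (G.Adj v w)) ∈ rowCompletions r := by
  induction l, r using RowFits.induct with
  | case1 => simp [rowCompletions]
  | case2 w l r ih =>
    obtain ⟨h1, h2⟩ := h
    simpa [rowCompletions, h1, Ne.symm h1.1] using ih h2
  | case3 w l r ih =>
    obtain ⟨h1, h2⟩ := h
    simpa [rowCompletions, h1, h1.ne] using ih h2
  | case4 w l r k h0 h1 ih =>
    rw [RowFits] at h
    · have := ih h.2
      rw [rowCompletions]
      · simp only [List.mem_cons, List.map_cons, List.mem_flatMap, this.1, h.1, or_self,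
          not_false_eq_true, true_and]
        refine ⟨_, this.2, ?_⟩
        by_cases hv : G.Adj v w <;> simp [hv]
      · exact h0
      · exact h1
    · exact h0
    · exact h1
  | case5 l r h1 h2 h3 h4 =>
    rw [RowFits] at h <;> first | exact h.elim | assumption

theorem Fits.spec {V : Type} {G : SimpleGraph V} {l : List V} {M : List (List ℕ)}
    (h : Fits G l M) : l.Nodup ∧ l.length = M.length ∧
      ∃ M' ∈ completions M, ∀ i j, ∀ hj : j < l.length, ∀ hi : i < l.length,
        triAdj M' i j = decide (G.Adj l[i] l[j]) := by
  induction l, M using Fits.induct with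
  | case1 => simp [completions]
  | case2 v l r M ih =>
    obtain ⟨h1, h2⟩ := h
    obtain ⟨hn, hl, M', hM', hadj⟩ := ih h2
    obtain ⟨hv, hr⟩ := h1.spec
    refine ⟨List.nodup_cons.2 ⟨hv, hn⟩, by simp [hl],
      (l.map fun w => decide (G.Adj v w)) :: M', ?_, ?_⟩
    · simp only [completions, List.mem_flatMap, List.mem_map]
      exact ⟨_, hr, M', hM', rfl⟩
    · intro i j hj hi
      rcases i with _ | i <;> rcases j with _ | j
      · simp [triAdj]
      · simp only [List.length_cons, Nat.add_lt_add_iff_right] at hj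
        simp [triAdj, hj]
      · simp only [List.length_cons, Nat.add_lt_add_iff_right] at hi
        simp [triAdj, hi, G.adj_comm]
      · simp only [List.length_cons, Nat.add_lt_add_iff_right] at hi hj
        rw [List.getElem_cons_succ, List.getElem_cons_succ, ← hadj i j hj hi, triAdj]
  | case3 l M h1 h2 =>
    rw [Fits] at h <;> first | exact h.elim | assumption

theorem Loc.absurd {V : Type} {G : SimpleGraph V} (hG : Loc G) (l : List V) (M : List (List ℕ))
    (hM : obstructs M = true) (hl : M.length ≤ 8) (h : Fits G l M) : False := by
  obtain ⟨hnd, hlen, M', hM', hadj⟩ := h.spec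
  obtain ⟨f, hinj, hf⟩ := hG {v | v ∈ l} l.finite_toSet (by
    have : {v | v ∈ l} = (l.toFinset : Set V) := by ext; simp
    rw [this, Set.ncard_coe_finset]
    exact (l.toFinset_card_le).trans (hlen.trans_le hl))
  unfold obstructs at hM
  rw [List.all_eq_true] at hM
  have := hM M' hM'
  simp only [Bool.not_eq_true'] at this
  rw [← Bool.not_eq_true] at this
  apply this
  have hrow : ∀ i j, ∀ hi : i < M.length, ∀ hj : j < M.length,
      (((List.range M.length).map fun i =>
        ofDigits2 ((List.range M.length).map (triAdj M' i))).getD i 0).testBit j = true ↔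
      G.Adj (l[i]'(hlen ▸ hi)) (l[j]'(hlen ▸ hj)) := by
    intro i j hi hj
    have h1 : ((List.range M.length).map fun i =>
        ofDigits2 ((List.range M.length).map (triAdj M' i))).getD i 0
        = ofDigits2 ((List.range M.length).map (triAdj M' i)) := by
      simp [List.getD_eq_getElem?_getD, hi]
    have h2 : ((List.range M.length).map (triAdj M' i)).getD j false = triAdj M' i j := by
      simp [List.getD_eq_getElem?_getD, hj]
    rw [h1, testBit_ofDigits2, h2, hadj i j (hlen ▸ hj) (hlen ▸ hi)]
    simp
  have hget : ∀ i, ∀ hi : i < M.length, (l.map f).getD i 0 = f (l[i]'(hlen ▸ hi)) := by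
    intro i hi
    simp [List.getD_eq_getElem?_getD, hlen ▸ hi]
  apply search_eq_true (g := fun i => (l.map f).getD i 0)
  · intro i hi j hj hij
    simp only [hget _ hi, hget _ hj] at hij
    exact (List.Nodup.getElem_inj_iff hnd).1 (hinj (by simp) (by simp) hij)
  · intro a ha b hb c hc d hd
    simp only [hget _ ha, hget _ hb, hget _ hc, hget _ hd]
    rw [hrow a c ha hc, hrow b d hb hd, hrow a d ha hd]
    exact hf _ (by simp) _ (by simp) _ (by simp) _ (by simp)
  · intro i
    simp [Nat.testBit_two_pow_sub_one]
  · intro i hi j hi'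
    simp [Nat.testBit_two_pow_sub_one, hi] at hi'
  · rw [Finset.filter_true_of_mem] <;> simp [Nat.testBit_two_pow_sub_one]

/-- In a multipartite tournament without directed cycles of length three and without directed
cycles of length four alternating between two parts, the relation extends to a linear order. -/
theorem exists_linearOrder_of_multipartite {α γ : Type*} (cls : α → γ) (r : α → α → Prop)
    (hcls : ∀ a b, r a b → cls a ≠ cls b) (htot : ∀ a b, cls a ≠ cls b → r a b ∨ r b a)
    (hasymm : ∀ a b, r a b → ¬ r b a) (h3 : ∀ a b c, r a b → r b c → ¬ r c a)
    (h4 : ∀ a b c d, cls a = cls c → cls b = cls d → r a b → r b c → r c d → ¬ r d a) :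
    ∃ s : α → α → Prop, IsStrictTotalOrder α s ∧ ∀ a b, r a b → s a b := by
  let r2 : α → α → Prop := fun a b => r a b ∨ (cls a = cls b ∧ ∃ m, r a m ∧ r m b)
  have h4' : ∀ a b c d, r a b → r b c → r c d → ¬ r d a := by
    intro a b c d hab hbc hcd hda
    by_cases hac : cls a = cls c
    · by_cases hbd : cls b = cls d
      · exact h4 a b c d hac hbd hab hbc hcd hda
      · rcases htot b d hbd with h | h
        · exact h3 _ _ _ hab h hda
        · exact h3 _ _ _ hbc hcd h
    · rcases htot a c hac with h | h
      · exact h3 _ _ _ h hcd hda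
      · exact h3 _ _ _ hab hbc h
  have key : ∀ a b c, r2 a b → r2 b c → r2 a c := by
    rintro a b c (hab | ⟨eab, m, ham, hmb⟩) (hbc | ⟨ebc, n, hbn, hnc⟩)
    · by_cases e : cls a = cls c
      · exact Or.inr ⟨e, b, hab, hbc⟩
      · exact Or.inl ((htot a c e).resolve_right (h3 _ _ _ hab hbc))
    · exact Or.inl ((htot a c (ebc ▸ hcls _ _ hab)).resolve_right (h4' _ _ _ _ hab hbn hnc))
    · exact Or.inl ((htot a c (eab ▸ hcls _ _ hbc)).resolve_right (h4' _ _ _ _ ham hmb hbc))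
    · refine Or.inr ⟨eab.trans ebc, m, ham, (htot m c ?_).resolve_right (h4' _ _ _ _ hbn hnc · hmb)⟩
      exact ebc ▸ hcls _ _ hmb
  have irr : ∀ a, ¬ r2 a a := by
    rintro a (h | ⟨-, m, h1, h2⟩)
    · exact hasymm _ _ h h
    · exact hasymm _ _ h1 h2
  let le : α → α → Prop := fun a b => a = b ∨ r2 a b
  have : IsPartialOrder α le :=
    { refl := fun a => Or.inl rfl
      trans := by
        rintro a b c (rfl | h1) (rfl | h2)
        · exact Or.inl rfl
        · exact Or.inr h2
        · exact Or.inr h1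
        · exact Or.inr (key _ _ _ h1 h2)
      antisymm := by
        rintro a b (rfl | h1) (h2 | h2)
        · rfl
        · rfl
        · exact h2.symm
        · exact absurd (key _ _ _ h1 h2) (irr _) }
  obtain ⟨s, hs, hle⟩ := extend_partialOrder le
  refine ⟨fun a b => s a b ∧ a ≠ b, ?_, fun a b hab =>
    ⟨hle _ _ (Or.inr (Or.inl hab)), fun h => hcls _ _ hab (h ▸ rfl)⟩⟩
  exact
    { irrefl := fun a h => h.2 rfl
      trans := fun a b c h1 h2 => ⟨hs.trans _ _ _ h1.1 h2.1, by
        rintro rfl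
        exact h1.2 (hs.antisymm _ _ h1.1 h2.1)⟩
      trichotomous := fun a b h1 h2 => by
        by_contra hne
        rcases hs.total a b with h | h
        · exact h1 ⟨h, hne⟩
        · exact h2 ⟨h, Ne.symm hne⟩ }

theorem exists_equiv_fin_of_isStrictTotalOrder {α : Type*} (B : Finset α)
    (s : ↥B → ↥B → Prop) (hs : IsStrictTotalOrder ↥B s) :
    ∃ σ : ↥B ≃ Fin B.card, ∀ v w, σ v < σ w ↔ s v w := by
  let := linearOrderOfSTO s
  let e := Fintype.orderIsoFinOfCardEq ↥B (Fintype.card_coe B)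
  exact ⟨e.symm.toEquiv, fun v w => e.symm.lt_iff_lt⟩

theorem IsThreadBlock.of_window {V : Type} {G : SimpleGraph V} (hG : Loc G) {a x y d : V}
    (hax : G.Adj a x) (hxy : G.Adj x y) (hyd : G.Adj y d)
    (hay : a ≠ y ∧ ¬ G.Adj a y) (had : a ≠ d ∧ ¬ G.Adj a d) (hxd : x ≠ d ∧ ¬ G.Adj x d)
    (B : Finset V) (hxB : x ∈ B) (hyB : y ∈ B)
    (hB : ∀ w ∈ B, w ≠ x → w ≠ y → (a ≠ w ∧ ¬ G.Adj a w) ∧ (w ≠ d ∧ ¬ G.Adj w d) ∧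
      (G.Adj w x ∨ G.Adj w y))
    (hA : ∀ v ∈ B, ∀ w ∈ B, v ≠ y → w ≠ y → G.Adj v x → ¬ G.Adj v y → G.Adj w x → ¬ G.Adj w y →
      ¬ G.Adj v w)
    (hC : ∀ v ∈ B, ∀ w ∈ B, v ≠ x → w ≠ x → G.Adj v y → ¬ G.Adj v x → G.Adj w y → ¬ G.Adj w x →
      ¬ G.Adj v w) : IsThreadBlock G B x y := by
  obtain ⟨r, hr⟩ : ∃ r : ↥B → ↥B → Prop, ∀ v w, r v w ↔ v.1 ≠ w.1 ∧ v.1 ≠ y ∧ w.1 ≠ x ∧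
      (v.1 = x ∨ w.1 = y ∨ ¬ (G.Adj w v ↔ G.Adj w y ∧ G.Adj v x)) := ⟨_, fun _ _ => Iff.rfl⟩
  obtain ⟨cls, hcl⟩ : ∃ cls : ↥B → ℕ, ∀ v, (cls v = 3 ∧ v.1 = x) ∨ (cls v = 4 ∧ v.1 = y) ∨
      (v.1 ≠ x ∧ v.1 ≠ y ∧ (a ≠ v ∧ ¬ G.Adj a v) ∧ (v.1 ≠ d ∧ ¬ G.Adj v d) ∧
      ((cls v = 0 ∧ G.Adj v x ∧ ¬ G.Adj v y) ∨ (cls v = 1 ∧ G.Adj v x ∧ G.Adj v y) ∨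
       (cls v = 2 ∧ ¬ G.Adj v x ∧ G.Adj v y))) := by
    refine ⟨fun v => if v.1 = x then 3 else if v.1 = y then 4 else
      if G.Adj v x then (if G.Adj v y then 1 else 0) else 2, fun v => ?_⟩
    by_cases h1 : v.1 = x
    · simp [h1]
    by_cases h2 : v.1 = y
    · simp [h2, hxy.ne']
    have := hB v v.2 h1 h2
    by_cases h3 : G.Adj v x <;> by_cases h4 : G.Adj v y <;> simp_all
  have hC' : ∀ v w : ↥B, cls v = 2 → cls w = 2 → ¬ G.Adj v w := by
    intro v w hv hw
    have h1 := hcl v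
    have h2 := hcl w
    have h3 := hC v v.2 w w.2
    grind
  have hA' : ∀ v w : ↥B, cls v = 0 → cls w = 0 → ¬ G.Adj v w := by
    intro v w hv hw
    have h1 := hcl v
    have h2 := hcl w
    have h3 := hA v v.2 w w.2
    grind
  clear hA hC hB
  have hK : ∀ v w : ↥B, v.1 ≠ w.1 → cls v = 1 → cls w = 1 → G.Adj v w := by
    intro v w hne hv hw
    by_contra hvw
    refine hG.absurd [a, x, y, d, v.1, w.1]
      [[1,0,0,0,0],[1,0,1,1],[1,1,1],[0,0],[0],[]] (by decide +kernel) (by decide) ?_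
    have h1 := hcl v
    have h2 := hcl w
    simp only [Fits, RowFits]
    grind (splits := 40) [SimpleGraph.adj_comm]
  have hcls : ∀ v w, r v w → cls v ≠ cls w := by
    intro v w h heq
    obtain ⟨hne, hvy, hwx, h⟩ := (hr _ _).1 h
    have h1 := hcl v
    have h2 := hcl w
    have h3 := hK v w hne
    have h4 := hA' v w
    have h5 := hC' v w
    grind (splits := 40) [SimpleGraph.adj_comm]
  have htot : ∀ v w, cls v ≠ cls w → r v w ∨ r w v := by
    intro v w hne
    have h1 := hcl v
    have h2 := hcl w
    have h3 : v.1 ≠ w.1 := fun h => hne (by rw [Subtype.ext h])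
    rw [hr, hr]
    grind (splits := 40) [SimpleGraph.adj_comm]
  have hasymm : ∀ v w, r v w → ¬ r w v := by
    intro v w h h'
    have h1 := hcl v
    have h2 := hcl w
    have h3 := hcls v w h
    rw [hr] at h h'
    grind (splits := 40) [SimpleGraph.adj_comm]
  have hfrom : ∀ v w, r v w → cls w ≠ 3 ∧ cls v ≠ 4 := by
    intro v w h
    have h1 := hcl v
    have h2 := hcl w
    rw [hr] at h
    grind
  have h3 : ∀ u v w, cls u = 0 → r u v → r v w → ¬ r w u := by
    intro u v w hu huv hvw hwu
    have hu1 := hcl u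
    have hv1 := hcl v
    have hw1 := hcl w
    have := hfrom _ _ huv
    have := hfrom _ _ hvw
    have := hfrom _ _ hwu
    have := hcls _ _ huv
    have := hcls _ _ hvw
    have := hcls _ _ hwu
    rw [hr] at huv hvw hwu
    clear hcl hfrom hcls hr htot hasymm hA' hC' hK
    by_cases hv : cls v = 1
    · have hw : cls w = 2 := by grind
      refine hG.absurd [a, x, y, d, u.1, v.1, w.1]
        [[1,0,0,0,0,0],[1,0,1,1,0],[1,0,1,1],[0,0,0],[0,1],[0],[]]
        (by decide +kernel) (by decide) ?_
      simp only [Fits, RowFits]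
      grind (splits := 40) [SimpleGraph.adj_comm]
    · have hv : cls v = 2 := by grind
      have hw : cls w = 1 := by grind
      refine hG.absurd [a, x, y, d, u.1, v.1, w.1]
        [[1,0,0,0,0,0],[1,0,1,0,1],[1,0,1,1],[0,0,0],[0,1],[1],[]]
        (by decide +kernel) (by decide) ?_
      simp only [Fits, RowFits]
      grind (splits := 40) [SimpleGraph.adj_comm]
  have h3' : ∀ u v w, r u v → r v w → ¬ r w u := by
    intro u v w huv hvw hwu
    have hu1 := hcl u
    have hv1 := hcl v
    have hw1 := hcl w
    have := hfrom _ _ huv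
    have := hfrom _ _ hvw
    have := hfrom _ _ hwu
    have := hcls _ _ huv
    have := hcls _ _ hvw
    have := hcls _ _ hwu
    by_cases hu : cls u = 0
    · exact h3 u v w hu huv hvw hwu
    by_cases hv : cls v = 0
    · exact h3 v w u hv hvw hwu huv
    by_cases hw : cls w = 0
    · exact h3 w u v hw hwu huv hvw
    grind
  have h4 : ∀ t u v w, cls t = cls v → cls u = cls w → cls t < cls u →
      r t u → r u v → r v w → ¬ r w t := by
    intro t u v w htv huw hlt htu huv hvw hwt
    have ht1 := hcl t
    have hu1 := hcl u
    have hv1 := hcl v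
    have hw1 := hcl w
    have := hfrom _ _ htu
    have := hfrom _ _ huv
    have := hfrom _ _ hvw
    have := hfrom _ _ hwt
    have hne1 : t.1 ≠ v.1 := fun h => hasymm _ _ htu (Subtype.ext h ▸ huv)
    have hne2 : u.1 ≠ w.1 := fun h => hasymm _ _ huv (Subtype.ext h ▸ hvw)
    have hA1 := hA' t v
    have hC1 := hC' u w
    have hK1 := hK t v hne1
    have hK2 := hK u w hne2
    rw [hr] at htu huv hvw hwt
    clear hcl hfrom hcls hr htot hasymm h3 h3' hA' hC' hK
    by_cases ht : cls t = 0
    · by_cases hu : cls u = 1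
      · refine hG.absurd [a, x, y, d, t.1, u.1, v.1, w.1]
          [[1,0,0,0,0,0,0],[1,0,1,1,1,1],[1,0,1,0,1],[0,0,0,0],[0,0,1],[1,1],[0],[]]
          (by decide +kernel) (by decide) ?_
        simp only [Fits, RowFits]
        grind (splits := 40) [SimpleGraph.adj_comm]
      · have hu : cls u = 2 := by grind
        refine hG.absurd [a, x, y, d, t.1, u.1, v.1, w.1]
          [[1,0,0,0,0,0,0],[1,0,1,0,1,0],[1,0,1,0,1],[0,0,0,0],[0,0,1],[1,0],[0],[]]
          (by decide +kernel) (by decide) ?_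
        simp only [Fits, RowFits]
        grind (splits := 40) [SimpleGraph.adj_comm]
    · have ht : cls t = 1 := by grind
      have hu : cls u = 2 := by grind
      refine hG.absurd [a, x, y, d, t.1, u.1, v.1, w.1]
        [[1,0,0,0,0,0,0],[1,0,1,0,1,0],[1,1,1,1,1],[0,0,0,0],[0,1,1],[1,0],[0],[]]
        (by decide +kernel) (by decide) ?_
      simp only [Fits, RowFits]
      grind (splits := 40) [SimpleGraph.adj_comm]
  have h4' : ∀ t u v w, cls t = cls v → cls u = cls w →
      r t u → r u v → r v w → ¬ r w t := by
    intro t u v w htv huw htu huv hvw hwt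
    rcases lt_trichotomy (cls t) (cls u) with h | h | h
    · exact h4 t u v w htv huw h htu huv hvw hwt
    · exact hcls _ _ htu h
    · exact h4 u v w t huw htv.symm (htv ▸ h) huv hvw hwt htu
  obtain ⟨s, hs, hrs⟩ := exists_linearOrder_of_multipartite cls r hcls htot hasymm h3' h4'
  · obtain ⟨σ, hσ⟩ := exists_equiv_fin_of_isStrictTotalOrder B s hs
    have hcard : 2 ≤ B.card := Finset.one_lt_card.2 ⟨x, hxB, y, hyB, hxy.ne⟩
    refine ⟨hcard, hxB, hyB, σ, fun v => G.Adj v x, fun v => G.Adj v y, ?_, ?_, hxy, G.irrefl, ?_,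
      hxy.symm, G.irrefl, ?_⟩
    · intro v
      have := hcl v
      by_cases h1 : v.1 = x
      · exact Or.inr (h1 ▸ hxy)
      by_cases h2 : v.1 = y
      · exact Or.inl (h2 ▸ hxy.symm)
      exact by grind
    · intro hx
      by_contra h0
      let w := σ.symm ⟨0, by omega⟩
      have hw : (σ w : ℕ) = 0 := by simp [w]
      have hne : w.1 ≠ x := by
        intro h
        have : w = ⟨x, hx⟩ := Subtype.ext h
        exact h0 (this ▸ hw)
      have h1 : s ⟨x, hx⟩ w := hrs _ _ <| (hr _ _).2 ⟨hne.symm, hxy.ne, hne, Or.inl rfl⟩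
      have h2 := (hσ _ _).2 h1
      rw [Fin.lt_def] at h2
      omega
    · intro hy
      by_contra h0
      let w := σ.symm ⟨B.card - 1, by omega⟩
      have hw : (σ w : ℕ) = B.card - 1 := by simp [w]
      have hne : w.1 ≠ y := by
        intro h
        have : w = ⟨y, hy⟩ := Subtype.ext h
        exact h0 (this ▸ hw)
      have h1 : s w ⟨y, hy⟩ := hrs _ _ <| (hr _ _).2 ⟨hne, hne, hxy.ne', Or.inr (Or.inl rfl)⟩
      have h2 := (hσ _ _).2 h1
      rw [Fin.lt_def] at h2
      have := (σ ⟨y, hy⟩).2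
      omega
    · intro v w hvw
      have hnot : ¬ r w v := by
        intro h
        have h2 := (hσ _ _).2 (hrs _ _ h)
        rw [Fin.lt_def] at h2
        omega
      have hne : v.1 ≠ w.1 := by
        intro h
        rw [Subtype.ext h] at hvw
        omega
      by_cases h1 : v.1 = x
      · rw [h1]
        simp [hxy, G.adj_comm]
      by_cases h2 : w.1 = y
      · rw [h2]
        simp [hxy.symm]
      have h3 : w.1 ≠ x := fun h => hnot <| (hr _ _).2 ⟨hne.symm, h ▸ hxy.ne, h1, Or.inl h⟩
      have h4 : v.1 ≠ y := fun h => hnot <| (hr _ _).2 ⟨hne.symm, h2, h1, Or.inr (Or.inl h)⟩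
      by_contra h5
      exact hnot <| (hr _ _).2 ⟨hne.symm, h2, h1, Or.inr (Or.inr h5)⟩

section

/-- `a, b, c, d, e` is an induced path. -/
def IndPath5 {V : Type} (G : SimpleGraph V) (a b c d e : V) : Prop :=
  G.Adj a b ∧ G.Adj b c ∧ G.Adj c d ∧ G.Adj d e ∧ (a ≠ c ∧ ¬ G.Adj a c) ∧ (a ≠ d ∧ ¬ G.Adj a d) ∧
    (a ≠ e ∧ ¬ G.Adj a e) ∧ (b ≠ d ∧ ¬ G.Adj b d) ∧ (b ≠ e ∧ ¬ G.Adj b e) ∧ (c ≠ e ∧ ¬ G.Adj c e)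

namespace Loc

variable {V : Type} {G : SimpleGraph V} {a b c d e u v s t : V}

theorem not_adj_two (hG : Loc G) (hP : IndPath5 G a b c d e)
    (ha : a ≠ u) (hc : c ≠ u) (he : e ≠ u) (hb : G.Adj u b) (hd : G.Adj u d) : False := by
  refine hG.absurd [a, b, c, d, e, u] [[1,0,0,0,2],[1,0,0,1],[1,0,2],[1,1],[2],[]]
    (by decide +kernel) (by decide) ?_
  unfold IndPath5 at hP
  simp only [Fits, RowFits]
  grind (splits := 40) [SimpleGraph.adj_comm]

theorem not_adj_far (hG : Loc G) (hP : IndPath5 G a b c d e)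
    (ha : a ≠ u ∧ ¬ G.Adj a u) (hb : b ≠ u) (hc : G.Adj c u) (hd : d ≠ u)
    (he : e ≠ u ∧ ¬ G.Adj e u) (huv : G.Adj u v) (hva : a ≠ v) (hvb : b ≠ v ∧ ¬ G.Adj b v)
    (hvc : c ≠ v ∧ ¬ G.Adj c v) (hvd : d ≠ v ∧ ¬ G.Adj d v) (hve : e ≠ v) : False := by
  refine hG.absurd [a, b, c, d, e, u, v]
    [[1,0,0,0,0,2],[1,0,0,2,0],[1,0,1,0],[1,2,0],[0,2],[1],[]]
    (by decide +kernel) (by decide) ?_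
  unfold IndPath5 at hP
  simp only [Fits, RowFits]
  grind (splits := 40) [SimpleGraph.adj_comm]

theorem not_adj_pendants (hG : Loc G) (hP : IndPath5 G a b c d e)
    (hua : a ≠ u ∧ ¬ G.Adj a u) (hub : b ≠ u ∧ ¬ G.Adj b u) (huc : G.Adj c u)
    (hud : d ≠ u ∧ ¬ G.Adj d u) (hue : e ≠ u ∧ ¬ G.Adj e u)
    (hva : a ≠ v ∧ ¬ G.Adj a v) (hvb : b ≠ v ∧ ¬ G.Adj b v) (hvc : G.Adj c v)
    (hvd : d ≠ v ∧ ¬ G.Adj d v) (hve : e ≠ v ∧ ¬ G.Adj e v) : ¬ G.Adj u v := by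
  intro huv
  refine hG.absurd [a, b, c, d, e, u, v]
    [[1,0,0,0,0,0],[1,0,0,0,0],[1,0,1,1],[1,0,0],[0,0],[1],[]]
    (by decide +kernel) (by decide) ?_
  unfold IndPath5 at hP
  simp only [Fits, RowFits]
  grind (splits := 40) [SimpleGraph.adj_comm]

theorem not_adj_consecutive (hG : Loc G) (hP : IndPath5 G a b c d e)
    (hua : a ≠ u ∧ ¬ G.Adj a u) (hub : G.Adj b u) (huc : G.Adj c u)
    (hud : d ≠ u ∧ ¬ G.Adj d u)
    (hva : a ≠ v ∧ ¬ G.Adj a v) (hvb : b ≠ v ∧ ¬ G.Adj b v) (hvc : G.Adj c v)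
    (hvd : G.Adj d v) : ¬ G.Adj u v := by
  intro huv
  refine hG.absurd [a, b, c, d, u, v]
    [[1,0,0,0,0],[1,0,1,0],[1,1,1],[0,1],[1],[]]
    (by decide +kernel) (by decide) ?_
  unfold IndPath5 at hP
  simp only [Fits, RowFits]
  grind (splits := 40) [SimpleGraph.adj_comm]

theorem not_two_sided (hG : Loc G) (hP : IndPath5 G a b c d e)
    (hsa : a ≠ s ∧ ¬ G.Adj a s) (hsb : b ≠ s ∧ ¬ G.Adj b s) (hsc : G.Adj c s)
    (hsd : d ≠ s ∧ ¬ G.Adj d s) (hse : e ≠ s ∧ ¬ G.Adj e s) (hst : G.Adj s t) (hsv : G.Adj s v)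
    (hta : a ≠ t ∧ ¬ G.Adj a t) (htb : b ≠ t ∧ ¬ G.Adj b t) (htc : c ≠ t) (htd : G.Adj d t)
    (hte : e ≠ t ∧ ¬ G.Adj e t)
    (hva : a ≠ v ∧ ¬ G.Adj a v) (hvb : G.Adj b v) (hvc : c ≠ v) (hvd : d ≠ v ∧ ¬ G.Adj d v)
    (hve : e ≠ v ∧ ¬ G.Adj e v) : False := by
  refine hG.absurd [a, b, c, d, e, s, t, v]
    [[1,0,0,0,0,0,0],[1,0,0,0,0,1],[1,0,1,2,2],[1,0,1,0],[0,0,0],[1,1],[2],[]]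
    (by decide +kernel) (by decide) ?_
  unfold IndPath5 at hP
  simp only [Fits, RowFits]
  grind (splits := 40) [SimpleGraph.adj_comm]

end Loc

/-- `c` is a (cyclically indexed) hole of `G` whose index ring has the distinguished step `o`,
no small multiple of which vanishes. -/
structure IsLongHole {V R : Type*} [CommRing R] (G : SimpleGraph V) (o : R) (c : R → V) : Prop where
  step : o ≠ 0 ∧ 2 * o ≠ 0 ∧ 3 * o ≠ 0 ∧ 4 * o ≠ 0 ∧ 5 * o ≠ 0 ∧ 6 * o ≠ 0
  inj : Function.Injective c
  adj_iff : ∀ i j, G.Adj (c i) (c j) ↔ j = i + o ∨ i = j + o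

namespace IsLongHole

variable {V R : Type} [CommRing R] {G : SimpleGraph V} {o : R} {c : R → V}

theorem indPath5 (hc : IsLongHole G o c) (i : R) :
    IndPath5 G (c (i - 2 * o)) (c (i - o)) (c i) (c (i + o)) (c (i + 2 * o)) := by
  obtain ⟨h1, h2, h3, h4, h5, h6⟩ := hc.step
  unfold IndPath5
  simp only [hc.adj_iff, hc.inj.ne_iff]
  refine ⟨?_, ?_, ?_, ?_, ?_, ?_, ?_, ?_, ?_, ?_⟩ <;> grind

theorem trace (hc : IsLongHole G o c) (hG : Loc G) {u : V} (hu : ∀ i, c i ≠ u) {i j : R}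
    (hi : G.Adj (c i) u) (hj : G.Adj (c j) u) : j = i - o ∨ j = i ∨ j = i + o := by
  obtain ⟨h1, h2, h3, h4, h5, h6⟩ := hc.step
  have two : ∀ i, G.Adj (c (i - o)) u → ¬ G.Adj (c (i + o)) u := fun i hb hd =>
    hG.not_adj_two (hc.indPath5 i) (hu _) (hu _) (hu _) hb.symm hd.symm
  have hp : ¬ G.Adj (c (i + 2 * o)) u := by
    have := two (i + o)
    rw [show i + o - o = i by ring, show i + o + o = i + 2 * o by ring] at this
    exact this hi
  have hm : ¬ G.Adj (c (i - 2 * o)) u := by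
    have := two (i - o)
    rw [show i - o - o = i - 2 * o by ring, show i - o + o = i by ring] at this
    exact fun h => this h hi
  by_contra hne
  push Not at hne
  have e1 : j ≠ i - 2 * o := fun h => hm (h ▸ hj)
  have e2 : j ≠ i + 2 * o := fun h => hp (h ▸ hj)
  have hcc := hc.adj_iff
  have hci := fun i j => hc.inj.ne_iff (x := i) (y := j)
  refine hG.not_adj_far (hc.indPath5 i) ⟨hu _, hm⟩ (hu _) hi (hu _) ⟨hu _, hp⟩ hj.symm ?_ ?_ ?_ ?_ ?_
  all_goals simp only [hcc, hci]
  all_goals grind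

theorem near (hc : IsLongHole G o c) (hG : Loc G) {u v : V} (hu : ∀ i, c i ≠ u) (hv : ∀ i, c i ≠ v)
    {i : R} (hi : G.Adj (c i) u) (huv : G.Adj u v) :
    G.Adj (c (i - o)) v ∨ G.Adj (c i) v ∨ G.Adj (c (i + o)) v := by
  obtain ⟨h1, h2, h3, h4, h5, h6⟩ := hc.step
  by_contra hne
  push Not at hne
  refine hG.not_adj_far (hc.indPath5 i) ⟨hu _, fun h => ?_⟩ (hu _) hi (hu _) ⟨hu _, fun h => ?_⟩ huv
    (hv _) ⟨hv _, hne.1⟩ ⟨hv _, hne.2.1⟩ ⟨hv _, hne.2.2⟩ (hv _)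
  all_goals
    have := hc.trace hG hu hi h
    grind

theorem exists_adj (hc : IsLongHole G o c) (hG : Loc G) (hconn : G.Connected) {u : V}
    (hu : ∀ i, c i ≠ u) : ∃ i, G.Adj (c i) u := by
  obtain ⟨w⟩ := hconn.preconnected (c 0) u
  have key : ∀ {x y : V}, G.Walk x y → ((∃ i, c i = x) ∨ ∃ i, G.Adj (c i) x) →
      ((∃ i, c i = y) ∨ ∃ i, G.Adj (c i) y) := by
    intro x y w
    induction w with
    | nil => exact id
    | @cons x y z hxy _ ih =>
      intro hx
      apply ih
      by_cases hy : ∃ i, c i = y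
      · exact Or.inl hy
      push Not at hy
      by_cases hx' : ∃ i, c i = x
      · obtain ⟨i, rfl⟩ := hx'
        exact Or.inr ⟨i, hxy⟩
      · push Not at hx'
        obtain ⟨i, hi⟩ := hx.resolve_left (by push Not; exact hx')
        rcases hc.near hG hx' hy hi hxy with h | h | h <;> exact Or.inr ⟨_, h⟩
  exact (key w (Or.inl ⟨0, rfl⟩)).resolve_left (by push Not; exact hu)

theorem not_adj_of_pendant (hc : IsLongHole G o c) (hG : Loc G) {u v : V} (hu : ∀ i, c i ≠ u)
    (hv : ∀ i, c i ≠ v) {i : R} (hiu : ∀ j, G.Adj (c j) u ↔ j = i)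
    (hiv : ∀ j, G.Adj (c j) v ↔ j = i) : ¬ G.Adj u v := by
  obtain ⟨h1, h2, h3, h4, h5, h6⟩ := hc.step
  refine hG.not_adj_pendants (hc.indPath5 i) ⟨hu _, ?_⟩ ⟨hu _, ?_⟩ ?_ ⟨hu _, ?_⟩ ⟨hu _, ?_⟩
    ⟨hv _, ?_⟩ ⟨hv _, ?_⟩ ?_ ⟨hv _, ?_⟩ ⟨hv _, ?_⟩
  all_goals simp only [hiu, hiv]
  all_goals grind

theorem trace_cases (hc : IsLongHole G o c) (hG : Loc G) (hconn : G.Connected) {u : V}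
    (hu : ∀ i, c i ≠ u) :
    ∃ i, (∀ j, G.Adj (c j) u ↔ j = i) ∨ (∀ j, G.Adj (c j) u ↔ j = i ∨ j = i + o) := by
  obtain ⟨h1, h2, h3, h4, h5, h6⟩ := hc.step
  obtain ⟨i, hi⟩ := hc.exists_adj hG hconn hu
  by_cases hp : G.Adj (c (i + o)) u
  · refine ⟨i, Or.inr fun j => ⟨fun hj => ?_, ?_⟩⟩
    · have := hc.trace hG hu hi hj
      have := hc.trace hG hu hp hj
      grind
    · rintro (rfl | rfl) <;> assumption
  by_cases hm : G.Adj (c (i - o)) u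
  · refine ⟨i - o, Or.inr fun j => ⟨fun hj => ?_, ?_⟩⟩
    · have := hc.trace hG hu hi hj
      have := hc.trace hG hu hm hj
      grind
    · rintro (rfl | rfl)
      · assumption
      · rwa [sub_add_cancel]
  · refine ⟨i, Or.inl fun j => ⟨fun hj => ?_, ?_⟩⟩
    · rcases hc.trace hG hu hi hj with rfl | rfl | rfl
      · exact absurd hj hm
      · rfl
      · exact absurd hj hp
    · rintro rfl
      exact hi

theorem trace_of_adj (hc : IsLongHole G o c) (hG : Loc G) (hconn : G.Connected) {u v : V}
    (hu : ∀ i, c i ≠ u) (hv : ∀ i, c i ≠ v) (huv : G.Adj u v) :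
    ∃ i, ∀ j, (G.Adj (c j) u ∨ G.Adj (c j) v) ↔ j = i ∨ j = i + o := by
  obtain ⟨h1, h2, h3, h4, h5, h6⟩ := hc.step
  have nuv := fun i hi => hc.near hG hu hv (i := i) hi huv
  have nvu := fun i hi => hc.near hG hv hu (i := i) hi huv.symm
  have hcons : ∀ {u v : V}, (∀ i, c i ≠ u) → (∀ i, c i ≠ v) → ∀ i,
      (∀ j, G.Adj (c j) u ↔ j = i ∨ j = i + o) →
      (∀ j, G.Adj (c j) v ↔ j = i + o ∨ j = i + o + o) → ¬ G.Adj u v := by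
    intro u v hu hv i hiu hiv
    refine hG.not_adj_consecutive (hc.indPath5 (i + o)) ⟨hu _, ?_⟩ ?_ ?_ ⟨hu _, ?_⟩
      ⟨hv _, ?_⟩ ⟨hv _, ?_⟩ ?_ ?_
    all_goals simp only [hiu, hiv]
    all_goals grind
  obtain ⟨i, hi⟩ := hc.trace_cases hG hconn hu
  obtain ⟨j, hj⟩ := hc.trace_cases hG hconn hv
  rcases hi with hi | hi <;> rcases hj with hj | hj <;> simp only [hi, hj] at nuv nvu ⊢
  · have e1 : i ≠ j := by
      rintro rfl
      exact hc.not_adj_of_pendant hG hu hv hi hj huv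
    have := nuv i rfl
    rcases this with h | h | h
    · exact ⟨j, fun k => by grind⟩
    · exact absurd h e1
    · exact ⟨i, fun k => by grind⟩
  · have := nuv i rfl
    have n2 := nvu j
    have n3 := nvu (j + o)
    have : i = j ∨ i = j + o := by grind
    rcases this with h | h <;> exact ⟨j, fun k => by grind⟩
  · have := nvu j rfl
    have n2 := nuv i
    have n3 := nuv (i + o)
    have : j = i ∨ j = i + o := by grind
    rcases this with h | h <;> exact ⟨i, fun k => by grind⟩
  · have e1 : j ≠ i + o := by
      rintro rfl
      exact hcons hu hv i hi hj huv
    have e2 : i ≠ j + o := by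
      rintro rfl
      exact hcons hv hu j hj hi huv.symm
    have n2 := nuv i
    have n3 := nuv (i + o)
    have : j = i := by grind
    exact ⟨i, fun k => by grind⟩

end IsLongHole

end

section

/-- The pendant vertex `w` at `c i` is placed in the block preceding `c i`. The predicate `side`
decides this when `w` has no neighbors outside the hole. -/
def OnLeft {V R : Type} [CommRing R] (G : SimpleGraph V) (o : R) (c : R → V) (side : R → Prop)
    (i : R) (w : V) : Prop :=
  (∃ t, (∀ k, c k ≠ t) ∧ G.Adj t w ∧ G.Adj (c (i - o)) t) ∨
    (side i ∧ ¬ ∃ t, (∀ k, c k ≠ t) ∧ G.Adj t w ∧ G.Adj (c (i + o)) t)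

/-- The vertices lying in the thread block of the arc from `c i` to `c (i + o)`. -/
def holeBlock {V R : Type} [CommRing R] (G : SimpleGraph V) (o : R) (c : R → V) (side : R → Prop)
    (i : R) : Set V :=
  {w | w = c i ∨ w = c (i + o) ∨ ((∀ k, c k ≠ w) ∧ (∀ j, G.Adj (c j) w → j = i ∨ j = i + o) ∧
    (∃ j, G.Adj (c j) w) ∧ (G.Adj (c i) w → G.Adj (c (i + o)) w ∨ ¬ OnLeft G o c side i w) ∧
    (G.Adj (c (i + o)) w → G.Adj (c i) w ∨ OnLeft G o c side (i + o) w))}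

namespace IsLongHole

variable {V R : Type} [CommRing R] {G : SimpleGraph V} {o : R} {c : R → V}

theorem isThreadBlock [Fintype V] (hc : IsLongHole G o c) (hG : Loc G) (side : R → Prop) (i : R) :
    IsThreadBlock G (holeBlock G o c side i).toFinset (c i) (c (i + o)) := by
  obtain ⟨h1, h2, h3, h4, h5, h6⟩ := hc.step
  have hcc := hc.adj_iff
  have hci := fun i j => hc.inj.ne_iff (x := i) (y := j)
  have hpend : ∀ {v}, v ∈ holeBlock G o c side i → v ≠ c i → v ≠ c (i + o) →
      (∀ k, c k ≠ v) ∧ (∀ j, G.Adj (c j) v → j = i ∨ j = i + o) ∧ (∃ j, G.Adj (c j) v) := by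
    rintro v (h | h | h) h1 h2
    · exact absurd h h1
    · exact absurd h h2
    · exact ⟨h.1, h.2.1, h.2.2.1⟩
  refine IsThreadBlock.of_window hG (a := c (i - o)) (d := c (i + 2 * o)) ?_ ?_ ?_ ?_ ?_ ?_ _
    ?_ ?_ ?_ ?_ ?_
  · simp only [hcc]; grind
  · simp only [hcc]; grind
  · simp only [hcc]; grind
  · simp only [hcc, hci]; grind
  · simp only [hcc, hci]; grind
  · simp only [hcc, hci]; grind
  · rw [Set.mem_toFinset]
    exact Or.inl rfl
  · rw [Set.mem_toFinset]
    exact Or.inr (Or.inl rfl)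
  · intro w hw hx hy
    rw [Set.mem_toFinset] at hw
    obtain ⟨hk, htr, j, hj⟩ := hpend hw hx hy
    refine ⟨⟨hk _, fun h => ?_⟩, ⟨(hk _).symm, fun h => ?_⟩, ?_⟩
    · have := htr _ h; grind
    · have := htr _ h.symm; grind
    · rcases htr _ hj with rfl | rfl
      · exact Or.inl hj.symm
      · exact Or.inr hj.symm
  · intro v hv w hw hvy hwy hvx hvn hwx hwn
    rw [Set.mem_toFinset] at hv hw
    obtain ⟨hk, htr, -⟩ := hpend hv hvx.ne hvy
    obtain ⟨hk', htr', -⟩ := hpend hw hwx.ne hwy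
    refine hc.not_adj_of_pendant hG hk hk' (i := i) (fun j => ⟨fun hj => ?_, ?_⟩)
      (fun j => ⟨fun hj => ?_, ?_⟩)
    · exact (htr j hj).resolve_right fun h => hvn (h ▸ hj.symm)
    · rintro rfl; exact hvx.symm
    · exact (htr' j hj).resolve_right fun h => hwn (h ▸ hj.symm)
    · rintro rfl; exact hwx.symm
  · intro v hv w hw hvx hwx hvy hvn hwy hwn
    rw [Set.mem_toFinset] at hv hw
    obtain ⟨hk, htr, -⟩ := hpend hv hvx hvy.ne
    obtain ⟨hk', htr', -⟩ := hpend hw hwx hwy.ne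
    refine hc.not_adj_of_pendant hG hk hk' (i := i + o) (fun j => ⟨fun hj => ?_, ?_⟩)
      (fun j => ⟨fun hj => ?_, ?_⟩)
    · exact (htr j hj).resolve_left fun h => hvn (h ▸ hj.symm)
    · rintro rfl; exact hvy.symm
    · exact (htr' j hj).resolve_left fun h => hwn (h ▸ hj.symm)
    · rintro rfl; exact hwy.symm

theorem holeBlock_inter (hc : IsLongHole G o c) (side : R → Prop) {i j : R} (hij : i ≠ j) :
    holeBlock G o c side i ∩ holeBlock G o c side j =
      ({c i, c (i + o)} : Set V) ∩ {c j, c (j + o)} := by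
  obtain ⟨h1, h2, h3, h4, h5, h6⟩ := hc.step
  have key : ∀ i w, (∀ k, c k ≠ w) → w ∈ holeBlock G o c side i →
      w ∉ holeBlock G o c side (i + o) := by
    rintro i w hk (h | h | ⟨-, a2, ⟨m, a3⟩, a4, a5⟩)
    · exact absurd h.symm (hk _)
    · exact absurd h.symm (hk _)
    rintro (h | h | ⟨-, b2, ⟨n, b3⟩, b4, b5⟩)
    · exact absurd h.symm (hk _)
    · exact absurd h.symm (hk _)
    have e : m = i + o := by
      have := a2 _ a3
      have := b2 _ a3
      grind
    subst e
    have n1 : ¬ G.Adj (c i) w := fun h => by have := b2 _ h; grind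
    have n2 : ¬ G.Adj (c (i + o + o)) w := fun h => by have := a2 _ h; grind
    exact ((b4 a3).resolve_left n2) ((a5 a3).resolve_left n1)
  ext w
  constructor
  · rintro ⟨hi, hj⟩
    by_cases hk : ∀ k, c k ≠ w
    · exfalso
      obtain ⟨m, hm⟩ : ∃ m, (m = i ∨ m = i + o) ∧ (m = j ∨ m = j + o) := by
        rcases hi with h | h | ⟨-, a2, ⟨m, a3⟩, -⟩
        · exact absurd h.symm (hk _)
        · exact absurd h.symm (hk _)
        rcases hj with h | h | ⟨-, b2, -⟩
        · exact absurd h.symm (hk _)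
        · exact absurd h.symm (hk _)
        exact ⟨m, a2 _ a3, b2 _ a3⟩
      have : j = i + o ∨ i = j + o := by grind
      rcases this with rfl | rfl
      · exact key _ _ hk hi hj
      · exact key _ _ hk hj hi
    · push Not at hk
      obtain ⟨k, rfl⟩ := hk
      refine ⟨?_, ?_⟩
      · rcases hi with h | h | h
        · exact Or.inl h
        · exact Or.inr h
        · exact absurd rfl (h.1 k)
      · rcases hj with h | h | h
        · exact Or.inl h
        · exact Or.inr h
        · exact absurd rfl (h.1 k)
  · rintro ⟨h | h, h' | h'⟩
    · exact ⟨Or.inl h, Or.inl h'⟩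
    · exact ⟨Or.inl h, Or.inr (Or.inl h')⟩
    · exact ⟨Or.inr (Or.inl h), Or.inl h'⟩
    · exact ⟨Or.inr (Or.inl h), Or.inr (Or.inl h')⟩

theorem exists_mem_holeBlock (hc : IsLongHole G o c) (hG : Loc G) (hconn : G.Connected)
    (side : R → Prop) (w : V) : ∃ i, w ∈ holeBlock G o c side i := by
  obtain ⟨h1, h2, h3, h4, h5, h6⟩ := hc.step
  by_cases hk : ∃ k, c k = w
  · obtain ⟨k, rfl⟩ := hk
    exact ⟨k, Or.inl rfl⟩
  push Not at hk
  obtain ⟨i, hi | hi⟩ := hc.trace_cases hG hconn hk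
  · by_cases hl : OnLeft G o c side i w
    · refine ⟨i - o, Or.inr (Or.inr ⟨hk, ?_, ⟨i, (hi i).2 rfl⟩, ?_, ?_⟩)⟩
      · intro j hj
        rw [hi] at hj
        exact Or.inr (by rw [hj]; ring)
      · rw [hi]
        grind
      · rw [sub_add_cancel]
        exact fun _ => Or.inr hl
    · refine ⟨i, Or.inr (Or.inr ⟨hk, ?_, ⟨i, (hi i).2 rfl⟩, ?_, ?_⟩)⟩
      · intro j hj
        exact Or.inl ((hi j).1 hj)
      · exact fun _ => Or.inr hl
      · rw [hi]
        grind
  · refine ⟨i, Or.inr (Or.inr ⟨hk, fun j => (hi j).1, ⟨i, (hi i).2 (Or.inl rfl)⟩, ?_, ?_⟩)⟩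
    · exact fun _ => Or.inl ((hi _).2 (Or.inr rfl))
    · exact fun _ => Or.inl ((hi _).2 (Or.inl rfl))

theorem mem_holeBlock_of_adj (hc : IsLongHole G o c) (hG : Loc G) (hconn : G.Connected)
    (side : R → Prop) {u v : V} (hu : ∀ k, c k ≠ u) (hv : ∀ k, c k ≠ v) (huv : G.Adj u v) {i : R}
    (hi : ∀ j, (G.Adj (c j) u ∨ G.Adj (c j) v) ↔ j = i ∨ j = i + o) :
    u ∈ holeBlock G o c side i := by
  obtain ⟨h1, h2, h3, h4, h5, h6⟩ := hc.step
  refine Or.inr (Or.inr ⟨hu, fun j hj => (hi j).1 (Or.inl hj), hc.exists_adj hG hconn hu, ?_, ?_⟩)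
  · intro hiu
    by_contra hcon
    push Not at hcon
    obtain ⟨hp, hl⟩ := hcon
    have hvp : G.Adj (c (i + o)) v := ((hi _).2 (Or.inr rfl)).resolve_left hp
    rcases hl with ⟨t, ht, htu, hti⟩ | ⟨-, hno⟩
    · obtain ⟨m, hm⟩ := hc.trace_of_adj hG hconn ht hu htu
      have m1 := (hm _).1 (Or.inl hti)
      have m2 := (hm _).1 (Or.inr hiu)
      have e : m = i - o := by grind
      subst e
      have hu' : ∀ j, G.Adj (c j) u → j = i := by
        intro j hj
        have n1 := (hi j).1 (Or.inl hj)
        have n2 := (hm j).1 (Or.inr hj)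
        grind
      refine hG.not_two_sided (hc.indPath5 i) ⟨hu _, fun h => ?_⟩ ⟨hu _, fun h => ?_⟩ hiu
        ⟨hu _, fun h => ?_⟩ ⟨hu _, fun h => ?_⟩ huv htu.symm
        ⟨hv _, fun h => ?_⟩ ⟨hv _, fun h => ?_⟩ (hv _) hvp ⟨hv _, fun h => ?_⟩
        ⟨ht _, fun h => ?_⟩ hti (ht _) ⟨ht _, fun h => ?_⟩ ⟨ht _, fun h => ?_⟩
      · have := hu' _ h; grind
      · have := hu' _ h; grind
      · have := hu' _ h; grind
      · have := hu' _ h; grind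
      · have := (hi _).1 (Or.inr h); grind
      · have := (hi _).1 (Or.inr h); grind
      · have := (hi _).1 (Or.inr h); grind
      · have := (hm _).1 (Or.inl h); grind
      · have := (hm _).1 (Or.inl h); grind
      · have := (hm _).1 (Or.inl h); grind
    · exact hno ⟨v, hv, huv.symm, hvp⟩
  · intro hiu
    by_cases hp : G.Adj (c i) u
    · exact Or.inl hp
    · refine Or.inr (Or.inl ⟨v, hv, huv.symm, ?_⟩)
      rw [add_sub_cancel_right]
      exact ((hi _).2 (Or.inl rfl)).resolve_left hp

theorem exists_mem_holeBlock_of_adj (hc : IsLongHole G o c) (hG : Loc G) (hconn : G.Connected)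
    (side : R → Prop) {u v : V} (huv : G.Adj u v) :
    ∃ i, u ∈ holeBlock G o c side i ∧ v ∈ holeBlock G o c side i := by
  have key : ∀ k {v}, (∀ k, c k ≠ v) → G.Adj (c k) v →
      ∃ i, c k ∈ holeBlock G o c side i ∧ v ∈ holeBlock G o c side i := by
    intro k v hv hkv
    obtain ⟨i, hi⟩ := hc.exists_mem_holeBlock hG hconn side v
    refine ⟨i, ?_, hi⟩
    rcases hi with h | h | ⟨-, h, -⟩
    · exact absurd h.symm (hv _)
    · exact absurd h.symm (hv _)
    · rcases h k hkv with rfl | rfl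
      · exact Or.inl rfl
      · exact Or.inr (Or.inl rfl)
  by_cases hu : ∃ k, c k = u
  · obtain ⟨k, rfl⟩ := hu
    by_cases hv : ∃ k, c k = v
    · obtain ⟨m, rfl⟩ := hv
      rcases (hc.adj_iff _ _).1 huv with rfl | rfl
      · exact ⟨k, Or.inl rfl, Or.inr (Or.inl rfl)⟩
      · exact ⟨m, Or.inr (Or.inl rfl), Or.inl rfl⟩
    · push Not at hv
      exact key k hv huv
  · push Not at hu
    by_cases hv : ∃ k, c k = v
    · obtain ⟨m, rfl⟩ := hv
      obtain ⟨i, h1, h2⟩ := key m hu huv.symm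
      exact ⟨i, h2, h1⟩
    · push Not at hv
      obtain ⟨i, hi⟩ := hc.trace_of_adj hG hconn hu hv huv
      exact ⟨i, hc.mem_holeBlock_of_adj hG hconn side hu hv huv hi,
        hc.mem_holeBlock_of_adj hG hconn side hv hu huv.symm fun j => by rw [or_comm, hi]⟩

end IsLongHole

/-- Long holes yield necklace decompositions. -/
theorem isNecklaceDecomp_of_hole {V : Type} [Fintype V] {G : SimpleGraph V} (hG : Loc G)
    (hconn : G.Connected) {n : ℕ} {c : ZMod (n + 1) → V} (hn : 9 ≤ n + 1)
    (hc : IsLongHole G 1 c) : ∃ (v : Fin (n + 1) → V) (B : Fin (n + 1) → Finset V),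
      IsNecklaceDecomp G (n + 1) v B := by
  have hs' : ∀ i : Fin (n + 1), cycSucc i = i + 1 := by
    intro i
    apply Fin.ext
    obtain ⟨n, rfl⟩ : ∃ m, n = m + 1 := ⟨n - 1, by omega⟩
    rw [Fin.val_add, Fin.val_one]
    rfl
  have hs : ∀ i : ZMod (n + 1), c (i + 1) = c (cycSucc (h := n + 1) i) :=
    fun i => congrArg c (hs' i).symm
  refine ⟨c, fun i => (holeBlock G 1 c (fun _ => False) i).toFinset, by omega, hc.inj, ?_, ?_, ?_, ?_⟩
  · intro (i : ZMod (n + 1))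
    have h := hc.isThreadBlock hG (fun _ => False) i
    rw [hs i] at h
    exact h
  · intro (i : ZMod (n + 1)) (j : ZMod (n + 1)) hij
    have h := hc.holeBlock_inter (fun _ => False) hij
    rw [hs i, hs j] at h
    simpa only [Set.coe_toFinset] using h
  · intro a
    simp only [Set.mem_toFinset]
    exact hc.exists_mem_holeBlock hG hconn _ a
  · intro a b hab
    simp only [Set.mem_toFinset]
    exact hc.exists_mem_holeBlock_of_adj hG hconn _ hab

/-- A graph in which some index ring `ZMod h` with `h ≥ 9` gives a hole. -/
theorem IsLongHole.zmod {V : Type} {G : SimpleGraph V} {h : ℕ} (h9 : 9 ≤ h) {c : ZMod h → V}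
    (inj : Function.Injective c) (adj_iff : ∀ i j, G.Adj (c i) (c j) ↔ j = i + 1 ∨ i = j + 1) :
    IsLongHole G 1 c := by
  have key : ∀ k : ℕ, 0 < k → k ≤ 8 → (k : ZMod h) ≠ 0 := by
    intro k h0 h8
    rw [Ne, ZMod.natCast_eq_zero_iff]
    exact Nat.not_dvd_of_pos_of_lt h0 (by omega)
  refine ⟨⟨?_, ?_, ?_, ?_, ?_, ?_⟩, inj, adj_iff⟩
  · simpa using key 1
  · simpa using key 2
  · simpa using key 3
  · simpa using key 4
  · simpa using key 5
  · simpa using key 6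

end

section

/-- The vertices `f 0, …, f k` form an induced path of `G`. -/
structure IsIndPath {V : Type} (G : SimpleGraph V) (k : ℕ) (f : ℕ → V) : Prop where
  adj_iff : ∀ i ≤ k, ∀ j ≤ k, G.Adj (f i) (f j) ↔ j = i + 1 ∨ i = j + 1
  inj : ∀ i ≤ k, ∀ j ≤ k, f i = f j → i = j

/-- `G` has no induced cycle of length at least nine. -/
def NoLongHole {V : Type} (G : SimpleGraph V) : Prop :=
  ∀ k f t, 7 ≤ k → IsIndPath G k f → ¬ ∀ i ≤ k, G.Adj t (f i) ↔ i = 0 ∨ i = k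

/-- Any two vertices of `D` are joined by a walk within `D`. -/
def ConnOn {V : Type} (G : SimpleGraph V) (D : Set V) : Prop :=
  ∀ x ∈ D, ∀ y ∈ D, Relation.ReflTransGen (fun a b => G.Adj a b ∧ b ∈ D) x y

variable {V : Type} {G : SimpleGraph V}

theorem ConnOn.union_singleton {D : Set V} (hD : ConnOn G D) {d s : V} (hd : d ∈ D) (hds : G.Adj d s) :
    ConnOn G (insert s D) := by
  have mono : ∀ x ∈ D, ∀ y ∈ D,
      Relation.ReflTransGen (fun a b => G.Adj a b ∧ b ∈ insert s D) x y := fun x hx y hy =>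
    Relation.ReflTransGen.mono (fun _ _ h => ⟨h.1, Or.inr h.2⟩) _ _ (hD x hx y hy)
  rintro x (rfl | hx) y (rfl | hy)
  · exact .refl
  · exact .head ⟨hds.symm, Or.inr hd⟩ (mono _ hd _ hy)
  · exact .tail (mono _ hx _ hd) ⟨hds, Or.inl rfl⟩
  · exact mono _ hx _ hy

theorem ConnOn.exists_adj {D : Set V} (hD : ConnOn G D) {P : V → Prop} {x y : V} (hx : x ∈ D)
    (hy : y ∈ D) (hPx : P x) (hPy : ¬ P y) :
    ∃ a ∈ D, ∃ b ∈ D, G.Adj a b ∧ P a ∧ ¬ P b := by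
  by_contra! h
  have : ∀ z, Relation.ReflTransGen (fun a b => G.Adj a b ∧ b ∈ D) x z → z ∈ D ∧ P z := by
    intro z hz
    induction hz with
    | refl => exact ⟨hx, hPx⟩
    | tail _ h1 ih => exact ⟨h1.2, h _ ih.1 _ h1.2 h1.1 ih.2⟩
  exact hPy (this y (hD x hx y hy)).2

theorem connOn_univ (hG : G.Connected) : ConnOn G Set.univ := by
  intro x _ y _
  have := (SimpleGraph.reachable_iff_reflTransGen x y).1 (hG.preconnected x y)
  exact Relation.ReflTransGen.mono (fun _ _ h => ⟨h, trivial⟩) _ _ this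

/-- A shortest path between two sets of vertices. -/
theorem ConnOn.exists_indPath {D X Y : Set V} (hD : ConnOn G D) (hX : X ⊆ D) (hY : Y ⊆ D)
    (hX0 : X.Nonempty) (hY0 : Y.Nonempty) :
    ∃ k f, IsIndPath G k f ∧ f 0 ∈ X ∧ f k ∈ Y ∧ (∀ i ≤ k, f i ∈ D) ∧
      (∀ i ≤ k, f i ∈ X → i = 0) ∧ (∀ i ≤ k, f i ∈ Y → i = k) := by
  let Q : ℕ → (ℕ → V) → Prop := fun k f =>
    f 0 ∈ X ∧ f k ∈ Y ∧ (∀ i ≤ k, f i ∈ D) ∧ ∀ i < k, G.Adj (f i) (f (i + 1))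
  have hex : ∃ k, ∃ f, Q k f := by
    obtain ⟨x, hx⟩ := hX0
    obtain ⟨y, hy⟩ := hY0
    suffices ∀ z, Relation.ReflTransGen (fun a b => G.Adj a b ∧ b ∈ D) x z →
        ∃ (k : ℕ) (f : ℕ → V), f 0 = x ∧ f k = z ∧ (∀ i ≤ k, f i ∈ D) ∧ ∀ i < k, G.Adj (f i) (f (i + 1)) by
      obtain ⟨k, f, h0, hk, h1, h2⟩ := this y (hD x (hX hx) y (hY hy))
      exact ⟨k, f, h0 ▸ hx, hk ▸ hy, h1, h2⟩
    intro z hz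
    induction hz with
    | refl => exact ⟨0, fun _ => x, rfl, rfl, fun _ _ => hX hx, by simp⟩
    | @tail b c _ h1 ih =>
      obtain ⟨k, f, h0, hk, hm, ha⟩ := ih
      refine ⟨k + 1, fun i => if i ≤ k then f i else c, ?_, ?_, ?_, ?_⟩
      · simp [h0]
      · simp
      · intro i hi
        dsimp only
        split_ifs with h
        · exact hm i h
        · exact h1.2
      · intro i hi
        rcases Nat.lt_succ_iff_lt_or_eq.1 hi with h | rfl
        · simp [h.le, Nat.succ_le_of_lt h, ha i h]
        · simp [hk, h1.1]
  obtain ⟨f, h0, hk, hm, ha⟩ := Nat.find_spec hex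
  set k := Nat.find hex with hkdef
  have hmin : ∀ m < k, ∀ g, ¬ Q m g := fun m hm g hg => Nat.find_min hex hm ⟨g, hg⟩
  have hcut : ∀ i j, i < j → j ≤ k → f i ≠ f j := by
    intro i j hij hj he
    refine hmin (k - (j - i)) (by omega) (fun m => if m ≤ i then f m else f (m + (j - i)))
      ⟨by simpa using h0, ?_, ?_, ?_⟩
    · dsimp only
      split_ifs with h
      · rwa [show k - (j - i) = i by omega, he, show j = k by omega]
      · rwa [Nat.sub_add_cancel (by omega)]
    · intro m hm'
      dsimp only
      split_ifs with h
      · exact hm _ (by omega)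
      · exact hm _ (by omega)
    · intro m hm'
      dsimp only
      split_ifs with h1 h2 h2
      · exact ha _ (by omega)
      · have := ha j (by omega)
        rw [show m = i by omega, he]
        convert this using 2
        omega
      · omega
      · have := ha (m + (j - i)) (by omega)
        convert this using 2
        omega
  have hshort : ∀ i j, i + 1 < j → j ≤ k → ¬ G.Adj (f i) (f j) := by
    intro i j hij hj he
    refine hmin (k - (j - i - 1)) (by omega) (fun m => if m ≤ i then f m else f (m + (j - i - 1)))
      ⟨by simpa using h0, ?_, ?_, ?_⟩
    · dsimp only
      rw [if_neg (by omega), Nat.sub_add_cancel (by omega)]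
      exact hk
    · intro m hm'
      dsimp only
      split_ifs with h
      · exact hm _ (by omega)
      · exact hm _ (by omega)
    · intro m hm'
      dsimp only
      split_ifs with h1 h2 h2
      · exact ha _ (by omega)
      · rw [show m = i by omega, show i + 1 + (j - i - 1) = j by omega]
        exact he
      · omega
      · have := ha (m + (j - i - 1)) (by omega)
        convert this using 2
        omega
  refine ⟨k, f, ⟨?_, ?_⟩, h0, hk, hm, ?_, ?_⟩
  · intro i hi j hj
    constructor
    · intro h
      by_contra hne
      rcases lt_trichotomy i j with h1 | rfl | h1
      · exact hshort i j (by omega) hj h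
      · exact h.ne rfl
      · exact hshort j i (by omega) hi h.symm
    · rintro (rfl | rfl)
      · exact ha _ (by omega)
      · exact (ha _ (by omega)).symm
  · intro i hi j hj h
    rcases lt_trichotomy i j with h1 | h1 | h1
    · exact absurd h (hcut i j h1 hj)
    · exact h1
    · exact absurd h.symm (hcut j i h1 hi)
  · intro i hi h
    by_contra h1
    refine hmin (k - i) (by omega) (fun m => f (m + i)) ⟨by simpa using h, ?_, ?_, ?_⟩
    · simpa [Nat.sub_add_cancel hi] using hk
    · intro m hm'
      exact hm _ (by omega)
    · intro m hm'
      have := ha (m + i) (by omega)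
      rwa [show m + i + 1 = m + 1 + i by omega] at this
  · intro i hi h
    by_contra h1
    exact hmin i (by omega) f ⟨h0, h, fun m hm' => hm _ (by omega), fun m hm' => ha _ (by omega)⟩

theorem IsIndPath.le_two (hG : Loc G) (hN : NoLongHole G) {k : ℕ} {f : ℕ → V} {t : V}
    (hf : IsIndPath G k f) (ht : ∀ i ≤ k, G.Adj t (f i) ↔ i = 0 ∨ i = k) : k ≤ 2 := by
  by_contra! hk
  have hne : ∀ i ≤ k, t ≠ f i := by
    rintro i hi rfl
    have h0 := (ht 0 (by omega)).2 (Or.inl rfl)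
    have h1 := (ht k le_rfl).2 (Or.inr rfl)
    rw [hf.adj_iff _ (by omega) _ (by omega)] at h0 h1
    omega
  have hadj := hf.adj_iff
  have hne' : ∀ i ≤ k, ∀ j ≤ k, i ≠ j → f i ≠ f j := fun i hi j hj h he => h (hf.inj i hi j hj he)
  rcases Nat.lt_or_ge k 7 with h7 | h7
  · interval_cases k
    · refine hG.absurd [f 0, f 1, f 2, f 3, t] [[1,0,0,1],[1,0,0],[1,0],[1],[]]
        (by decide +kernel) (by decide) ?_
      simp only [Fits, RowFits]
      grind (splits := 40) [SimpleGraph.adj_comm]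
    · refine hG.absurd [f 0, f 1, f 2, f 3, f 4, t]
        [[1,0,0,0,1],[1,0,0,0],[1,0,0],[1,0],[1],[]] (by decide +kernel) (by decide) ?_
      simp only [Fits, RowFits]
      grind (splits := 40) [SimpleGraph.adj_comm]
    · refine hG.absurd [f 0, f 1, f 2, f 3, f 4, f 5, t]
        [[1,0,0,0,0,1],[1,0,0,0,0],[1,0,0,0],[1,0,0],[1,0],[1],[]] (by decide +kernel)
        (by decide) ?_
      simp only [Fits, RowFits]
      grind (splits := 40) [SimpleGraph.adj_comm]
    · refine hG.absurd [f 0, f 1, f 2, f 3, f 4, f 5, f 6, t]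
        [[1,0,0,0,0,0,1],[1,0,0,0,0,0],[1,0,0,0,0],[1,0,0,0],[1,0,0],[1,0],[1],[]]
        (by decide +kernel) (by decide) ?_
      simp only [Fits, RowFits]
      grind (splits := 40) [SimpleGraph.adj_comm]
  · exact hN k f t h7 hf ht

/-- A connected set `D` that leaves some vertex `r` undominated, chosen so that every outer
neighbor of `D` is adjacent to every undominated vertex. -/
theorem exists_maximal_undominating [Finite V] {M : Set V} {a b : V} (ha : a ∈ M) (hb : b ∈ M)
    (hab : a ≠ b) (hadj : ¬ G.Adj a b) :
    ∃ D ⊆ M, D.Nonempty ∧ ConnOn G D ∧ (∃ r ∈ M, r ∉ D ∧ ∀ d ∈ D, ¬ G.Adj d r) ∧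
      ∀ s ∈ M, s ∉ D → ∀ d ∈ D, G.Adj d s → ∀ r ∈ M, r ∉ D → (∀ d ∈ D, ¬ G.Adj d r) →
        G.Adj s r := by
  let F : Set (Set V) := {D | D ⊆ M ∧ D.Nonempty ∧ ConnOn G D ∧
    ∃ r ∈ M, r ∉ D ∧ ∀ d ∈ D, ¬ G.Adj d r}
  have hF : {a} ∈ F := by
    refine ⟨by simpa using ha, by simp, ?_, b, hb, by simpa using hab.symm, by simpa using hadj⟩
    rintro x rfl y rfl
    exact .refl
  obtain ⟨D, hD⟩ := F.toFinite.exists_maximal ⟨_, hF⟩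
  obtain ⟨h1, h2, h3, h4⟩ := hD.prop
  refine ⟨D, h1, h2, h3, h4, ?_⟩
  intro s hs hsD d hd hds r hr hrD hrd
  by_contra hsr
  have hmem : insert s D ∈ F := by
    refine ⟨Set.insert_subset hs h1, by simp, h3.union_singleton hd hds, r, hr, ?_, ?_⟩
    · rintro (rfl | h)
      · exact hrd d hd hds
      · exact hrD h
    · rintro d' (rfl | h)
      · exact hsr
      · exact hrd _ h
  exact hsD (hD.le_of_ge hmem (Set.subset_insert s D) (Or.inl rfl))

/-- Finite cographs with at least two vertices have twins. -/
theorem exists_twins_of_no_P4 [Finite V] (n : ℕ) : ∀ M : Set V, M.ncard ≤ n → M.Nontrivial →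
    (∀ a ∈ M, ∀ b ∈ M, ∀ c ∈ M, ∀ d ∈ M, G.Adj a b → G.Adj b c → G.Adj c d → a ≠ c → ¬ G.Adj a c →
      b ≠ d → ¬ G.Adj b d → a ≠ d → G.Adj a d) →
    ∃ u ∈ M, ∃ v ∈ M, u ≠ v ∧ ∀ w ∈ M, w ≠ u → w ≠ v → (G.Adj u w ↔ G.Adj v w) := by
  induction n with
  | zero =>
    intro M hM hnt
    have := Set.one_lt_ncard_iff_nontrivial.2 hnt
    omega
  | succ n ih =>
    intro M hM hnt hP
    by_cases hcl : ∀ a ∈ M, ∀ b ∈ M, a ≠ b → G.Adj a b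
    · obtain ⟨a, ha, b, hb, hab⟩ := hnt
      exact ⟨a, ha, b, hb, hab, fun w hw h1 h2 => by simp [hcl a ha w hw h1.symm,
        hcl b hb w hw h2.symm]⟩
    push Not at hcl
    obtain ⟨a, ha, b, hb, hab, hadj⟩ := hcl
    obtain ⟨D, hDM, ⟨d, hd⟩, hconn, ⟨r, hr, hrD, hrd⟩, hmax⟩ :=
      exists_maximal_undominating ha hb hab hadj
    have hmod : ∀ N ⊆ M, N.ncard < M.ncard → N.Nontrivial →
        (∀ w ∈ M, w ∉ N → ∀ u ∈ N, ∀ v ∈ N, (G.Adj u w ↔ G.Adj v w)) →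
        ∃ u ∈ M, ∃ v ∈ M, u ≠ v ∧ ∀ w ∈ M, w ≠ u → w ≠ v → (G.Adj u w ↔ G.Adj v w) := by
      intro N hN hlt hnt hmod
      obtain ⟨u, hu, v, hv, huv, h⟩ := ih N (by omega) hnt
        fun a ha b hb c hc d hd => hP a (hN ha) b (hN hb) c (hN hc) d (hN hd)
      refine ⟨u, hN hu, v, hN hv, huv, fun w hw h1 h2 => ?_⟩
      by_cases hwN : w ∈ N
      · exact h w hwN h1 h2
      · exact hmod w hw hwN u hu v hv
    have hlt : ∀ N ⊆ M, ∀ z ∈ M, z ∉ N → N.ncard < M.ncard := fun N hN z hz hzN =>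
      Set.ncard_lt_ncard (Set.ssubset_iff_subset_ne.2 ⟨hN, fun h => hzN (h ▸ hz)⟩) M.toFinite
    by_cases hR : {r ∈ M | r ∉ D ∧ ∀ d ∈ D, ¬ G.Adj d r}.Nontrivial
    · refine hmod _ (fun x hx => hx.1) (hlt _ (fun x hx => hx.1) d (hDM hd) fun h => h.2.1 hd) hR ?_
      intro w hw hwR u hu v hv
      by_cases hwD : w ∈ D
      · have h1 := hu.2.2 w hwD
        have h2 := hv.2.2 w hwD
        rw [G.adj_comm u, G.adj_comm v]
        tauto
      · have : ∃ d ∈ D, G.Adj d w := by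
          by_contra! h
          exact hwR ⟨hw, hwD, h⟩
        obtain ⟨d', hd', h⟩ := this
        have h1 := hmax w hw hwD d' hd' h u hu.1 hu.2.1 hu.2.2
        have h2 := hmax w hw hwD d' hd' h v hv.1 hv.2.1 hv.2.2
        simp [h1.symm, h2.symm]
    · have hRr : ∀ z ∈ M, z ∉ D → (∀ d ∈ D, ¬ G.Adj d z) → z = r := fun z h1 h2 h3 =>
        Set.not_nontrivial_iff.1 hR ⟨h1, h2, h3⟩ ⟨hr, hrD, hrd⟩
      have hSD : ∀ s ∈ M, s ∉ D → s ≠ r → ∀ d ∈ D, G.Adj s d := by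
        intro s hs hsD hsr
        by_contra! hcon
        obtain ⟨y, hy, hsy⟩ := hcon
        obtain ⟨x, hx, hxs⟩ : ∃ d ∈ D, G.Adj d s := by
          by_contra! h
          exact hsr (hRr s hs hsD h)
        obtain ⟨p, hp, q, hq, hpq, hsp, hsq⟩ :=
          hconn.exists_adj (P := fun z => G.Adj s z) hx hy hxs.symm hsy
        have := hP q (hDM hq) p (hDM hp) s hs r hr hpq.symm hsp.symm
          (hmax s hs hsD x hx hxs r hr hrD hrd) (fun h => hsD (h ▸ hq)) (fun h => hsq h.symm)
          (fun h => hrD (h ▸ hp)) (hrd p hp) (fun h => hrD (h ▸ hq))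
        exact hrd q hq this
      by_cases hDn : D.Nontrivial
      · refine hmod D hDM (hlt D hDM r hr hrD) hDn ?_
        intro w hw hwD u hu v hv
        by_cases hwr : w = r
        · subst hwr
          simp [hrd u hu, hrd v hv]
        · simp [(hSD w hw hwD hwr u hu).symm, (hSD w hw hwD hwr v hv).symm]
      · refine ⟨d, hDM hd, r, hr, fun h => hrD (h ▸ hd), fun w hw h1 h2 => ?_⟩
        have hwD : w ∉ D := fun h => h1 (Set.not_nontrivial_iff.1 hDn h hd)
        have h3 := hSD w hw hwD h2 d hd
        simp [h3.symm, (hmax w hw hwD d hd h3.symm r hr hrD hrd).symm]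

end

section

variable {V : Type} {G : SimpleGraph V}

theorem no_P4_of_dominating (hG : Loc G) {M : Set V} {s : V} (hs : ∀ m ∈ M, G.Adj s m) :
    ∀ a ∈ M, ∀ b ∈ M, ∀ c ∈ M, ∀ d ∈ M, G.Adj a b → G.Adj b c → G.Adj c d → a ≠ c → ¬ G.Adj a c →
      b ≠ d → ¬ G.Adj b d → a ≠ d → G.Adj a d := by
  intro a ha b hb c hc d hd h1 h2 h3 h4 h5 h6 h7 h8
  by_contra h9
  refine hG.absurd [s, a, b, c, d] [[1,1,1,1],[1,0,0],[1,0],[1],[]] (by decide +kernel)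
    (by decide) ?_
  simp only [Fits, RowFits]
  exact ⟨⟨hs a ha, hs b hb, hs c hc, hs d hd, trivial⟩, ⟨h1, ⟨h4, h5⟩, ⟨h8, h9⟩, trivial⟩,
    ⟨h2, ⟨h6, h7⟩, trivial⟩, ⟨h3, trivial⟩, trivial, trivial⟩

/-- Two neighbors of a connected set `D` that share a neighbor outside of `D ∪ N(D)` have the
same neighbors in `D`. -/
theorem adj_of_common_nbr (hG : Loc G) (hN : NoLongHole G) {D : Set V} (hD : ConnOn G D)
    {r s s' : V} (hrD : ∀ d ∈ D, ¬ G.Adj d r) (hr : r ∉ D) (hsD : s ∉ D) (hsD' : s' ∉ D)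
    (hss : s ≠ s') (hrs : G.Adj r s) (hrs' : G.Adj r s') {x y : V} (hx : x ∈ D) (hsx : G.Adj s x)
    (hy : y ∈ D) (hsy' : G.Adj s' y) : G.Adj s' x := by
  have hcommon : ∃ z ∈ D, G.Adj s z ∧ G.Adj s' z := by
    have hD' := hD.union_singleton hy hsy'.symm
    by_cases hadj : G.Adj s s'
    · obtain ⟨k, f, hf, h0, hk, hm, hX, hY⟩ := hD'.exists_indPath (X := {z ∈ D | G.Adj s z})
        (Y := {s'}) (fun z hz => Or.inr hz.1) (by simp) ⟨x, hx, hsx⟩ ⟨s', rfl⟩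
      have hk0 : k ≠ 0 := by
        rintro rfl
        exact hsD' (hk ▸ h0.1)
      have hk2 : k ≤ 2 := hf.le_two hG hN (t := s) fun i hi => by
        constructor
        · intro h
          rcases hm i hi with h1 | h1
          · exact Or.inr (hY i hi h1)
          · exact Or.inl (hX i hi ⟨h1, h⟩)
        · rintro (rfl | rfl)
          · exact h0.2
          · exact hk ▸ hadj
      have hadjf := hf.adj_iff
      replace hk0 := Nat.pos_of_ne_zero hk0
      interval_cases k
      · refine ⟨f 0, h0.1, h0.2, ?_⟩
        rw [← show f 1 = s' from hk]
        exact (hadjf _ (by omega) _ (by omega)).2 (by omega)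
      · exfalso
        have h2 : f 2 = s' := hk
        have h1 : f 1 ∈ D := (hm 1 (by omega)).resolve_left fun h => by
          have := hY 1 (by omega) h
          omega
        have h3 : ¬ G.Adj s (f 1) := fun h => by
          have := hX 1 (by omega) ⟨h1, h⟩
          omega
        have a1 := hadjf 0 (by omega) 1 (by omega)
        have a2 := hadjf 1 (by omega) 2 (by omega)
        have a3 := hadjf 0 (by omega) 2 (by omega)
        have r0 := hrD _ h0.1
        have r1 := hrD _ h1
        have e0 : f 0 ≠ s' := fun h => hsD' (h ▸ h0.1)
        have e1 : f 1 ≠ s := fun h => hsD (h ▸ h1)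
        have e2 : f 0 ≠ r := fun h => hr (h ▸ h0.1)
        have e3 : f 1 ≠ r := fun h => hr (h ▸ h1)
        refine hG.absurd [s, f 0, f 1, s', r] [[1,0,1,1],[1,0,0],[1,0],[1],[]] (by decide +kernel)
          (by decide) ?_
        simp only [Fits, RowFits]
        grind (splits := 40) [SimpleGraph.adj_comm]
    · obtain ⟨k, f, hf, h0, hk, hm, hX, hY⟩ := (hD'.union_singleton (Or.inr hx)
        hsx.symm).exists_indPath (X := {s}) (Y := {s'}) (by simp) (by simp) ⟨s, rfl⟩ ⟨s', rfl⟩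
      have h0 : f 0 = s := h0
      have hk : f k = s' := hk
      have hk2 : k ≤ 2 := hf.le_two hG hN (t := r) fun i hi => by
        constructor
        · intro h
          rcases hm i hi with h1 | h1 | h1
          · exact Or.inl (hX i hi h1)
          · exact Or.inr (hY i hi h1)
          · exact absurd h.symm (hrD _ h1)
        · rintro (rfl | rfl)
          · rwa [h0]
          · rwa [hk]
      have hadjf := hf.adj_iff
      interval_cases k
      · exact absurd (h0.symm.trans hk) hss
      · exact absurd ((hadjf 0 (by omega) 1 (by omega)).2 (by omega)) (by rwa [h0, hk])
      · refine ⟨f 1, ?_, ?_, ?_⟩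
        · rcases hm 1 (by omega) with h1 | h1 | h1
          · exact absurd (hX 1 (by omega) h1) (by omega)
          · exact absurd (hY 1 (by omega) h1) (by omega)
          · exact h1
        · rw [← h0]
          exact (hadjf _ (by omega) _ (by omega)).2 (by omega)
        · rw [← hk]
          exact (hadjf _ (by omega) _ (by omega)).2 (by omega)
  by_contra hnx
  obtain ⟨z, hz, hsz, hsz'⟩ := hcommon
  obtain ⟨k, f, hf, h0, hk, hm, hX, hY⟩ := hD.exists_indPath
    (X := {w ∈ D | G.Adj s w ∧ G.Adj s' w}) (Y := {w ∈ D | ¬ (G.Adj s w ↔ G.Adj s' w)})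
    (fun w hw => hw.1) (fun w hw => hw.1) ⟨z, hz, hsz, hsz'⟩ ⟨x, hx, by simp [hsx, hnx]⟩
  have hmid : ∀ i ≤ k, i ≠ 0 → i ≠ k → ¬ G.Adj s (f i) ∧ ¬ G.Adj s' (f i) := by
    intro i hi h1 h2
    have h3 := fun h => h1 (hX i hi ⟨hm i hi, h⟩)
    have h4 := fun h => h2 (hY i hi ⟨hm i hi, h⟩)
    tauto
  have main : ∀ s₁ s₂ : V, s₁ ≠ s₂ → G.Adj r s₁ → G.Adj r s₂ → s₁ ∉ D → s₂ ∉ D →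
      G.Adj s₁ (f 0) → G.Adj s₂ (f 0) → G.Adj s₁ (f k) → ¬ G.Adj s₂ (f k) →
      (∀ i ≤ k, i ≠ 0 → i ≠ k → ¬ G.Adj s₁ (f i) ∧ ¬ G.Adj s₂ (f i)) → False := by
    intro s₁ s₂ hne hr1 hr2 hD1 hD2 h10 h20 h1k h2k hmid
    have hk0 : k ≠ 0 := by
      rintro rfl
      exact h2k h20
    have hk2 : k ≤ 2 := hf.le_two hG hN (t := s₁) fun i hi => by
      constructor
      · intro h
        by_contra! h'
        exact (hmid i hi h'.1 h'.2).1 h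
      · rintro (rfl | rfl)
        · exact h10
        · exact h1k
    have hadjf := hf.adj_iff
    have hr' : ∀ i ≤ k, f i ≠ r ∧ ¬ G.Adj (f i) r ∧ f i ≠ s₁ ∧ f i ≠ s₂ := fun i hi =>
      ⟨fun h => hr (h ▸ hm i hi), hrD _ (hm i hi), fun h => hD1 (h ▸ hm i hi),
        fun h => hD2 (h ▸ hm i hi)⟩
    replace hk0 := Nat.pos_of_ne_zero hk0
    interval_cases k
    · have a1 := hadjf 0 (by omega) 1 (by omega)
      have b0 := hr' 0 (by omega)
      have b1 := hr' 1 (by omega)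
      refine hG.absurd [f 0, f 1, s₁, s₂, r] [[1,1,1,0],[1,0,0],[2,1],[1],[]] (by decide +kernel)
        (by decide) ?_
      simp only [Fits, RowFits]
      grind (splits := 40) [SimpleGraph.adj_comm]
    · have a1 := hadjf 0 (by omega) 1 (by omega)
      have a2 := hadjf 1 (by omega) 2 (by omega)
      have a3 := hadjf 0 (by omega) 2 (by omega)
      have b0 := hr' 0 (by omega)
      have b1 := hr' 1 (by omega)
      have b2 := hr' 2 (by omega)
      have c1 := hmid 1 (by omega) (by omega) (by omega)
      have e := hf.inj 0 (by omega) 2 (by omega)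
      refine hG.absurd [f 0, f 1, f 2, s₁, s₂, r] [[1,0,1,1,0],[1,0,0,0],[1,0,0],[2,1],[1],[]]
        (by decide +kernel) (by decide) ?_
      simp only [Fits, RowFits]
      grind (splits := 40) [SimpleGraph.adj_comm]
  have hk' := hk.2
  by_cases h : G.Adj s (f k)
  · exact main s s' hss hrs hrs' hsD hsD' h0.2.1 h0.2.2 h (by tauto) hmid
  · exact main s' s hss.symm hrs' hrs hsD' hsD h0.2.2 h0.2.1 (by tauto) h
      fun i hi h1 h2 => (hmid i hi h1 h2).symm

/-- Connected graphs without small obstructions and without long holes have twins or a vertex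
of degree one. -/
theorem exists_twins_or_pendant [Finite V] [Nontrivial V] (hG : Loc G) (hN : NoLongHole G)
    (hconn : G.Connected) : ∃ u v : V, u ≠ v ∧
      ((∀ w, w ≠ u → w ≠ v → (G.Adj u w ↔ G.Adj v w)) ∨
        (G.Adj u v ∧ ∀ w, w ≠ u → ¬ G.Adj v w)) := by
  by_cases hcl : ∀ a b, a ≠ b → G.Adj a b
  · obtain ⟨a, b, hab⟩ := exists_pair_ne V
    exact ⟨a, b, hab, Or.inl fun w h1 h2 => by simp [hcl a w h1.symm, hcl b w h2.symm]⟩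
  push Not at hcl
  obtain ⟨a, b, hab, hadj⟩ := hcl
  obtain ⟨D, -, ⟨d, hd⟩, hD, ⟨r, -, hrD, hrd⟩, hmax⟩ :=
    exists_maximal_undominating (Set.mem_univ a) (Set.mem_univ b) hab hadj
  replace hmax : ∀ s ∉ D, ∀ d ∈ D, G.Adj d s → ∀ r ∉ D, (∀ d ∈ D, ¬ G.Adj d r) → G.Adj s r :=
    fun s h1 d h2 h3 r h4 h5 => hmax s trivial h1 d h2 h3 r trivial h4 h5
  have hmod : ∀ N : Set V, N.Nontrivial → (∃ s, ∀ m ∈ N, G.Adj s m) →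
      (∀ w ∉ N, ∀ u ∈ N, ∀ v ∈ N, G.Adj u w → G.Adj v w) →
      ∃ u v : V, u ≠ v ∧ ∀ w, w ≠ u → w ≠ v → (G.Adj u w ↔ G.Adj v w) := by
    rintro N hN ⟨s, hs⟩ hmod
    obtain ⟨u, hu, v, hv, huv, h⟩ := exists_twins_of_no_P4 _ N le_rfl hN (no_P4_of_dominating hG hs)
    refine ⟨u, v, huv, fun w h1 h2 => ?_⟩
    by_cases hw : w ∈ N
    · exact h w hw h1 h2
    · exact ⟨hmod w hw u hu v hv, hmod w hw v hv u hu⟩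
  obtain ⟨p, -, s, -, hps, hp, hsD⟩ := (connOn_univ hconn).exists_adj (P := fun z => z ∈ D)
    (Set.mem_univ d) (Set.mem_univ r) hd hrD
  by_cases hR : {r | r ∉ D ∧ ∀ d ∈ D, ¬ G.Adj d r}.Nontrivial
  · obtain ⟨u, v, huv, h⟩ := hmod _ hR ⟨s, fun m hm => hmax s hsD p hp hps m hm.1 hm.2⟩ (by
      intro w hwR u hu v hv huw
      have hwD : w ∉ D := fun h => hu.2 w h huw.symm
      have : ∃ d ∈ D, G.Adj d w := by
        by_contra! h
        exact hwR ⟨hwD, h⟩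
      obtain ⟨d', hd', h⟩ := this
      exact (hmax w hwD d' hd' h v hv.1 hv.2).symm)
    exact ⟨u, v, huv, Or.inl h⟩
  have hRr : ∀ z ∉ D, (∀ d ∈ D, ¬ G.Adj d z) → z = r := fun z h2 h3 =>
    Set.not_nontrivial_iff.1 hR ⟨h2, h3⟩ ⟨hrD, hrd⟩
  have hS : ∀ w, G.Adj r w → w ∉ D ∧ ∃ d ∈ D, G.Adj d w := by
    intro w hw
    have hwD : w ∉ D := fun h => hrd w h hw.symm
    refine ⟨hwD, ?_⟩
    by_contra! h
    exact hw.ne (hRr w hwD h).symm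
  by_cases hSn : {w | G.Adj r w}.Nontrivial
  · obtain ⟨u, v, huv, h⟩ := hmod _ hSn ⟨r, fun m hm => hm⟩ (by
      intro w hwS u hu v hv huw
      by_cases hwr : w = r
      · subst hwr
        exact hv.symm
      have hwD : w ∈ D := by
        by_contra h
        by_cases h' : ∃ d ∈ D, G.Adj d w
        · obtain ⟨d', hd', h'⟩ := h'
          exact hwS (hmax w h d' hd' h' r hrD hrd).symm
        · push Not at h'
          exact hwr (hRr w h h')
      by_cases huv : u = v
      · exact huv ▸ huw
      obtain ⟨y, hy, hyv⟩ := (hS v hv).2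
      exact adj_of_common_nbr hG hN hD hrd hrD (hS u hu).1 (hS v hv).1 huv hu hv hwD huw hy
        hyv.symm)
    exact ⟨u, v, huv, Or.inl h⟩
  · have hsr := hmax s hsD p hp hps r hrD hrd
    refine ⟨s, r, hsr.ne, Or.inr ⟨hsr, fun w h1 h2 => h1 ?_⟩⟩
    exact Set.not_nontrivial_iff.1 hSn h2 hsr.symm

end

section

variable {V : Type} {G : SimpleGraph V}

theorem OrdOn.neg {s : Set V} {f : V → ℤ} (h : OrdOn G s f) : OrdOn G s (fun v => - f v) := by
  refine ⟨fun a ha b hb hab => h.1 ha hb (neg_injective hab), ?_⟩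
  intro a ha b hb c hc d hd hac had hbc hbd h1 h2
  exact (h.2 d hd c hc b hb a ha (neg_lt_neg_iff.1 hbd) (neg_lt_neg_iff.1 had)
    (neg_lt_neg_iff.1 hbc) (neg_lt_neg_iff.1 hac) h2.symm h1.symm).symm

theorem exists_lex [Finite V] (b f : V → ℤ) :
    ∃ g : V → ℤ, ∀ a c, g a < g c ↔ b a < b c ∨ b a = b c ∧ f a < f c := by
  cases nonempty_fintype V
  obtain ⟨N, hN⟩ : ∃ N : ℤ, ∀ v, |f v| < N :=
    ⟨∑ v, |f v| + 1, fun v => Int.lt_add_one_of_le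
      (Finset.single_le_sum (f := fun v => |f v|) (fun _ _ => abs_nonneg _) (Finset.mem_univ v))⟩
  refine ⟨fun v => 2 * N * b v + f v, fun a c => ?_⟩
  have ha := abs_lt.1 (hN a)
  have hc := abs_lt.1 (hN c)
  rcases lt_trichotomy (b a) (b c) with h | h | h
  · simp only [h, true_or, iff_true]
    nlinarith
  · simp [h]
  · simp only [h.not_gt, h.ne', false_and, or_self, iff_false, not_lt]
    nlinarith

/-- The map `f` orders the vertices other than `u'`, which are connected. -/
structure Inserting (G : SimpleGraph V) (f : V → ℤ) (u u' : V) : Prop where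
  ne : u ≠ u'
  loc : Loc G
  ord : OrdOn G {v | v ≠ u'} f
  conn : ConnOn G {v | v ≠ u'}

namespace Inserting

variable {f : V → ℤ} {u u' : V}

theorem neg (h : Inserting G f u u') : Inserting G (fun v => - f v) u u' :=
  ⟨h.ne, h.loc, h.ord.neg, h.conn⟩

theorem closed (h : Inserting G f u u') (P : V → Prop)
    (hP : ∀ a b, a ≠ u' → b ≠ u' → G.Adj a b → P a → P b) {q : V} (hq : q ≠ u') (hPq : P q) :
    P u := by
  by_contra hu
  obtain ⟨a, ha, b, hb, hab, h1, h2⟩ := h.conn.exists_adj hq h.ne hPq hu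
  exact h2 (hP a b ha hb hab h1)

theorem of_blocks [Finite V] (h : Inserting G f u u') (r : V → ℤ) (hr : ∀ v, v ≠ u' → r v ≠ r u')
    (H : ∀ a b c d, r a < r c ∨ r a = r c ∧ f a < f c → r a < r d ∨ r a = r d ∧ f a < f d →
      r b < r c ∨ r b = r c ∧ f b < f c → r b < r d ∨ r b = r d ∧ f b < f d →
      G.Adj a c → G.Adj b d → G.Adj a d) : ∃ g, OrdOn G Set.univ g := by
  have hinj : ∀ a b, a ≠ u' → b ≠ u' → f a = f b → a = b := fun a b ha hb => h.ord.1 ha hb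
  obtain ⟨g, hg⟩ := exists_lex r f
  refine ⟨g, ?_, ?_⟩
  · intro a _ b _ hab
    have h1 := hg a b
    have h2 := hg b a
    have h3 : r a = r b ∧ f a = f b := by omega
    by_cases ha : a = u'
    · subst ha
      by_contra hne
      exact hr b (Ne.symm hne) h3.1.symm
    · by_cases hb : b = u'
      · subst hb
        exact absurd h3.1 (hr a ha)
      · exact hinj a b ha hb h3.2
  · intro a _ b _ c _ d _ hac had hbc hbd
    rw [hg] at hac had hbc hbd
    exact H a b c d hac had hbc hbd

theorem ord' (h : Inserting G f u u') : ∀ a b c d, a ≠ u' → b ≠ u' → c ≠ u' → d ≠ u' →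
    f a < f c → f a < f d → f b < f c → f b < f d → G.Adj a c → G.Adj b d → G.Adj a d :=
  fun a b c d ha hb hc hd => h.ord.2 a ha b hb c hc d hd

theorem inj' (h : Inserting G f u u') : ∀ a b, a ≠ u' → b ≠ u' → f a = f b → a = b :=
  fun _ _ ha hb => h.ord.1 ha hb

/-- A twin of `u` is placed next to `u`. -/
theorem of_twin [Finite V] (h : Inserting G f u u')
    (h1 : G.Adj u u' → ∀ x y, x ≠ u' → y ≠ u' → f x < f u → f u < f y → G.Adj x y →
      G.Adj u x ∧ G.Adj u y)
    (h2 : ∀ x y, x ≠ u' → y ≠ u' → f x < f u → f u < f y → G.Adj u x → G.Adj u y →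
      G.Adj x y ∧ G.Adj u u')
    (hu : ∀ w, w ≠ u → w ≠ u' → (G.Adj u w ↔ G.Adj u' w)) :
    ∃ g, OrdOn G Set.univ g := by
  have hne := h.ne
  have hinj := h.inj'
  have hord := h.ord'
  refine h.of_blocks (fun v => if v = u' then 2 else if v = u then 1 else
    if f v < f u then 0 else 3) ?_ ?_
  · grind
  intro a b c d hac had hbc hbd hac' hbd'
  by_cases huu : G.Adj u u'
  · have h1' := h1 huu
    clear h1
    grind (splits := 40) [SimpleGraph.adj_comm]
  · clear h1
    grind (splits := 40) [SimpleGraph.adj_comm]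

/-- A pendant vertex at `u` is placed next to `u`. -/
theorem of_pendant [Finite V] (h : Inserting G f u u')
    (h1 : ∀ x y, x ≠ u' → y ≠ u' → f x < f u → f u < f y → ¬ G.Adj x y)
    (hu : ∀ w, w ≠ u → ¬ G.Adj u' w) :
    ∃ g, OrdOn G Set.univ g := by
  have hne := h.ne
  have hinj := h.inj'
  have hord := h.ord'
  refine h.of_blocks (fun v => if v = u' then 2 else if v = u then 1 else
    if f v < f u then 0 else 3) ?_ ?_
  · grind
  intro a b c d hac had hbc hbd hac' hbd'
  grind (splits := 40) [SimpleGraph.adj_comm]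

set_option maxHeartbeats 2000000 in
theorem of_poor_clique [Finite V] (h : Inserting G f u u')
    (hxy : ∀ x y, x ≠ u' → y ≠ u' → f x < f u → f u < f y → (G.Adj x y ↔ G.Adj u x ∧ G.Adj u y))
    (hux : ∀ x, x ≠ u' → f x < f u → G.Adj u x)
    (hcl : ∀ x x', x ≠ u' → x' ≠ u' → f x < f u → f x' < f u → x ≠ x' → G.Adj x x')
    (hu : (¬ G.Adj u u' ∧ ∀ w, w ≠ u → w ≠ u' → (G.Adj u w ↔ G.Adj u' w)) ∨
      (G.Adj u u' ∧ ∀ w, w ≠ u → ¬ G.Adj u' w)) :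
    ∃ g, OrdOn G Set.univ g := by
  have hne := h.ne
  have hinj := h.inj'
  have hord := h.ord'
  rcases hu with hu | hu
  · refine h.of_blocks (fun v => if v = u then 0 else if v = u' then 1 else
      if f v < f u then 2 else 3) ?_ ?_
    · grind
    intro a b c d hac had hbc hbd h1 h2
    grind (splits := 40) [SimpleGraph.adj_comm]
  · refine h.of_blocks (fun v => if v = u' then 0 else if v = u then 1 else
      if f v < f u then 2 else 3) ?_ ?_
    · grind
    intro a b c d hac had hbc hbd h1 h2
    grind (splits := 40) [SimpleGraph.adj_comm]

set_option maxHeartbeats 2000000 in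
theorem of_poor_star [Finite V] (h : Inserting G f u u') {p : V} (hp : p ≠ u') (hpu : f p < f u)
    (hup : G.Adj u p) (hux : ∀ x, x ≠ u' → f x < f u → G.Adj u x → x = p)
    (huy : ∀ y, y ≠ u' → f u < f y → ¬ G.Adj u y)
    (hx : ∀ x w, x ≠ u' → w ≠ u' → f x < f u → x ≠ p → G.Adj x w → w = p)
    (hxp : ∀ x, x ≠ u' → f x < f u → x ≠ p → G.Adj x p)
    (huu : G.Adj u u')
    (hu : (∀ w, w ≠ u → w ≠ u' → (G.Adj u w ↔ G.Adj u' w)) ∨ (∀ w, w ≠ u → ¬ G.Adj u' w)) :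
    ∃ g, OrdOn G Set.univ g := by
  have hne := h.ne
  have hinj := h.inj'
  have hord := h.ord'
  have hpu' : p ≠ u := by
    rintro rfl
    exact lt_irrefl _ hpu
  rcases hu with hu | hu
  · refine h.of_blocks (fun v => if v = u then 0 else if v = u' then 1 else
      if f v < f u then (if v = p then 3 else 2) else 4) ?_ ?_
    · grind
    intro a b c d hac had hbc hbd h1 h2
    grind (splits := 40) [SimpleGraph.adj_comm]
  · refine h.of_blocks (fun v => if v = u' then 0 else if v = u then 1 else
      if f v < f u then (if v = p then 3 else 2) else 4) ?_ ?_
    · grind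
    intro a b c d hac had hbc hbd h1 h2
    have hc := hu c
    have hd := hu d
    grind (splits := 40) [SimpleGraph.adj_comm]

set_option maxHeartbeats 2000000 in
theorem of_poor_independent [Finite V] (h : Inserting G f u u')
    (huy : ∀ y, y ≠ u' → f u < f y → ¬ G.Adj u y)
    (hxy : ∀ x y, x ≠ u' → y ≠ u' → f x < f u → f u < f y → (G.Adj x y ↔ G.Adj u x))
    (hy : ∀ y y', y ≠ u' → y' ≠ u' → f u < f y → f u < f y' → ¬ G.Adj y y')
    (hu : (∀ w, w ≠ u → w ≠ u' → (G.Adj u w ↔ G.Adj u' w)) ∨ (∀ w, w ≠ u → ¬ G.Adj u' w)) :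
    ∃ g, OrdOn G Set.univ g := by
  have hne := h.ne
  have hinj := h.inj'
  have hord := h.ord'
  refine h.of_blocks (fun v => if v = u' then 3 else if v = u then 2 else
    if f v < f u then 0 else 1) ?_ ?_
  · grind
  intro a b c d hac had hbc hbd h1 h2
  grind (splits := 40) [SimpleGraph.adj_comm]

set_option maxHeartbeats 2000000 in
theorem of_poor_leaves [Finite V] (h : Inserting G f u u')
    (hxy : ∀ x y, x ≠ u' → y ≠ u' → f x < f u → f u < f y → ¬ G.Adj x y)
    (hx : ∀ x x', x ≠ u' → x' ≠ u' → f x < f u → f x' < f u → ¬ G.Adj x x')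
    (hu : ∀ w, w ≠ u → w ≠ u' → (G.Adj u w ↔ G.Adj u' w)) :
    ∃ g, OrdOn G Set.univ g := by
  have hne := h.ne
  have hinj := h.inj'
  have hord := h.ord'
  refine h.of_blocks (fun v => if v = u then 0 else if v = u' then 1 else
    if f v < f u then 2 else 3) ?_ ?_
  · grind
  intro a b c d hac had hbc hbd h1 h2
  grind (splits := 40) [SimpleGraph.adj_comm]

end Inserting

end

section

variable {V : Type} {G : SimpleGraph V} {f : V → ℤ} {u u' : V}

theorem not_rich_clique (hG : Loc G) {p q p' q' : V} (hu : u ≠ u')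
    (hpq : p ≠ q) (hpq' : p' ≠ q') (hp : G.Adj u p) (hp' : G.Adj u p')
    (hq : G.Adj u q ↔ ¬ G.Adj p q) (hq' : G.Adj u q' ↔ ¬ G.Adj p' q')
    (h1 : G.Adj p p') (h2 : G.Adj p q' ↔ G.Adj u q') (h3 : G.Adj q p' ↔ G.Adj u q)
    (h4 : G.Adj q q' ↔ G.Adj u q ∧ G.Adj u q') (hne : u ≠ q ∧ u ≠ q' ∧ q ≠ p' ∧ p ≠ q' ∧ q ≠ q')
    (hne' : u' ≠ p ∧ u' ≠ p' ∧ u' ≠ q ∧ u' ≠ q')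
    (huu : (¬ G.Adj u u' ∧ ∀ w, w ≠ u → w ≠ u' → (G.Adj u w ↔ G.Adj u' w)) ∨
      (G.Adj u u' ∧ ∀ w, w ≠ u → ¬ G.Adj u' w)) : False := by
  rcases huu with ⟨h5, h6⟩ | ⟨h5, h6⟩
  · have key : ∀ α β : Bool, obstructs [[0, 1, bif α then 1 else 0, 1, bif β then 1 else 0],
        [1, bif α then 1 else 0, 1, bif β then 1 else 0],
        [bif α then 0 else 1, 1, bif β then 1 else 0],
        [bif α then 1 else 0, bif α && β then 1 else 0], [bif β then 0 else 1], []] = true := by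
      decide +kernel
    refine hG.absurd [u, u', p, q, p', q'] _ (key (decide (G.Adj u q)) (decide (G.Adj u q')))
      (by simp) ?_
    have := h6 p
    have := h6 q
    have := h6 p'
    have := h6 q'
    by_cases hα : G.Adj u q <;> by_cases hβ : G.Adj u q' <;>
      simp only [hα, hβ, decide_true, decide_false, cond_true, cond_false, Bool.and_true,
        Bool.and_false, Fits, RowFits] <;> grind
  · have key : ∀ α β : Bool, obstructs [[1, 1, bif α then 1 else 0, 1, bif β then 1 else 0],
        [0, 0, 0, 0],
        [bif α then 0 else 1, 1, bif β then 1 else 0],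
        [bif α then 1 else 0, bif α && β then 1 else 0], [bif β then 0 else 1], []] = true := by
      decide +kernel
    refine hG.absurd [u, u', p, q, p', q'] _ (key (decide (G.Adj u q)) (decide (G.Adj u q')))
      (by simp) ?_
    have := h6 p
    have := h6 q
    have := h6 p'
    have := h6 q'
    by_cases hα : G.Adj u q <;> by_cases hβ : G.Adj u q' <;>
      simp only [hα, hβ, decide_true, decide_false, cond_true, cond_false, Bool.and_true,
        Bool.and_false, Fits, RowFits] <;> grind

theorem not_rich_star (hG : Loc G) {p q y y' : V} (hp : G.Adj u p) (hq : G.Adj u q) (hpq : p ≠ q)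
    (huy : u ≠ y ∧ ¬ G.Adj u y) (huy' : u ≠ y' ∧ ¬ G.Adj u y') (hpy : G.Adj p y) (hqy : G.Adj q y)
    (hyy : G.Adj y y') (hpy' : G.Adj p y' ↔ G.Adj q y')
    (hne : p ≠ y' ∧ q ≠ y') (hne' : u' ≠ p ∧ u' ≠ q ∧ u' ≠ y ∧ u' ≠ y') (huu : G.Adj u u')
    (hu : (∀ w, w ≠ u → w ≠ u' → (G.Adj u w ↔ G.Adj u' w)) ∨ (∀ w, w ≠ u → ¬ G.Adj u' w)) :
    False := by
  have key : ∀ α β : Bool, obstructs [[1, 1, 1, 0, 0],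
      [bif α then 1 else 0, bif α then 1 else 0, 0, 0], [2, 1, bif β then 1 else 0],
      [1, bif β then 1 else 0], [1], []] = true := by
    decide +kernel
  refine hG.absurd [u, u', p, q, y, y'] _ (key (decide (G.Adj u' p)) (decide (G.Adj p y')))
    (by simp) ?_
  rcases hu with h6 | h6 <;>
  · have := h6 p
    have := h6 q
    have := h6 y
    have := h6 y'
    by_cases hα : G.Adj u' p <;> by_cases hβ : G.Adj p y' <;>
      simp only [hα, hβ, decide_true, decide_false, cond_true, cond_false, Fits, RowFits] <;> grind

theorem not_rich_path (hG : Loc G) {p q q' y y' : V} (hp : G.Adj u p) (hq : u ≠ q ∧ ¬ G.Adj u q)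
    (hq' : u ≠ q' ∧ ¬ G.Adj u q') (hpq : G.Adj p q) (hqq : G.Adj q q') (hpq' : p ≠ q')
    (huy : u ≠ y ∧ ¬ G.Adj u y) (huy' : u ≠ y' ∧ ¬ G.Adj u y') (hpy : G.Adj p y)
    (hqy : ¬ G.Adj q y ∧ ¬ G.Adj q y' ∧ ¬ G.Adj q' y ∧ ¬ G.Adj q' y')
    (hyy : G.Adj y y') (hne : p ≠ y' ∧ q ≠ y ∧ q ≠ y' ∧ q' ≠ y ∧ q' ≠ y')
    (hne' : u' ≠ p ∧ u' ≠ q ∧ u' ≠ q' ∧ u' ≠ y ∧ u' ≠ y') (huu : G.Adj u u')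
    (hu : (∀ w, w ≠ u → w ≠ u' → (G.Adj u w ↔ G.Adj u' w)) ∨ (∀ w, w ≠ u → ¬ G.Adj u' w)) :
    False := by
  have key : ∀ α β : Bool, obstructs [[1, 1, 0, 0, 0, 0],
      [bif α then 1 else 0, 0, 0, 0, 0], [1, 2, 1, bif β then 1 else 0],
      [1, 0, 0], [0, 0], [1], []] = true := by
    decide +kernel
  refine hG.absurd [u, u', p, q, q', y, y'] _ (key (decide (G.Adj u' p)) (decide (G.Adj p y')))
    (by simp) ?_
  rcases hu with h6 | h6 <;>
  · have := h6 p
    have := h6 q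
    have := h6 q'
    have := h6 y
    have := h6 y'
    by_cases hα : G.Adj u' p <;> by_cases hβ : G.Adj p y' <;>
      simp only [hα, hβ, decide_true, decide_false, cond_true, cond_false, Fits, RowFits] <;> grind

theorem not_rich_leaves (hG : Loc G) {p q p' q' : V} (hu : u ≠ u')
    (hp : G.Adj u p) (hp' : G.Adj u p') (hpq : G.Adj p q) (hpq' : G.Adj p' q')
    (h1 : ¬ G.Adj p p' ∧ ¬ G.Adj p q' ∧ ¬ G.Adj q p' ∧ ¬ G.Adj q q')
    (hne : u ≠ q ∧ u ≠ q' ∧ q ≠ p' ∧ p ≠ q' ∧ q ≠ q' ∧ p ≠ p')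
    (hne' : u' ≠ p ∧ u' ≠ p' ∧ u' ≠ q ∧ u' ≠ q')
    (h6 : ∀ w, w ≠ u → w ≠ u' → (G.Adj u w ↔ G.Adj u' w)) : False := by
  have key : ∀ α β γ : Bool, obstructs [[bif γ then 1 else 0, 1, bif α then 1 else 0, 1,
      bif β then 1 else 0], [1, bif α then 1 else 0, 1, bif β then 1 else 0],
      [1, 0, 0], [0, 0], [1], []] = true := by
    decide +kernel
  refine hG.absurd [u, u', p, q, p', q'] _
    (key (decide (G.Adj u q)) (decide (G.Adj u q')) (decide (G.Adj u u'))) (by simp) ?_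
  have e1 := (h6 p hp.ne' hne'.1.symm).1 hp
  have e2 := h6 q hne.1.symm hne'.2.2.1.symm
  have e3 := (h6 p' hp'.ne' hne'.2.1.symm).1 hp'
  have e4 := h6 q' hne.2.1.symm hne'.2.2.2.symm
  have e5 := hp.ne
  have e6 := hp'.ne
  by_cases hα : G.Adj u q <;> by_cases hβ : G.Adj u q' <;> by_cases hγ : G.Adj u u' <;>
    simp_all [Fits, RowFits]

end

section

namespace Inserting

variable {V : Type} [Finite V] {G : SimpleGraph V} {f : V → ℤ} {u u' : V}

theorem of_left_leaves (h : Inserting G f u u')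
    (hxy : ∀ x y, x ≠ u' → y ≠ u' → f x < f u → f u < f y → ¬ G.Adj x y)
    (hX : ∀ p q, p ≠ u' → q ≠ u' → f p < f u → f q < f u → G.Adj u p → ¬ G.Adj p q)
    (hu : ∀ w, w ≠ u → w ≠ u' → (G.Adj u w ↔ G.Adj u' w)) :
    ∃ g, OrdOn G Set.univ g := by
  have hinj := h.inj'
  have hne := h.ne
  have hux : ∀ x, x ≠ u' → f x < f u → G.Adj u x := by
    intro x hx hxu
    by_contra hc
    have := h.closed (fun v => f v < f u ∧ ¬ G.Adj u v) (fun a b ha hb hab hP => by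
      have := hinj b u hb hne
      have := hxy a b ha hb hP.1
      have := hX b a hb ha
      grind [SimpleGraph.adj_comm]) hx ⟨hxu, hc⟩
    exact lt_irrefl _ this.1
  exact h.of_poor_leaves hxy (fun x x' hx hx' h1 h2 => hX x x' hx hx' h1 h2 (hux x hx h1)) hu

theorem exists_ordOn_of_no_cross (h : Inserting G f u u')
    (hxy : ∀ x y, x ≠ u' → y ≠ u' → f x < f u → f u < f y → ¬ G.Adj x y)
    (hu : (∀ w, w ≠ u → w ≠ u' → (G.Adj u w ↔ G.Adj u' w)) ∨
      (G.Adj u u' ∧ ∀ w, w ≠ u → ¬ G.Adj u' w)) : ∃ g, OrdOn G Set.univ g := by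
  rcases hu with hu | ⟨-, hu⟩
  swap
  · exact h.of_pendant hxy hu
  by_cases hX : ∀ p q, p ≠ u' → q ≠ u' → f p < f u → f q < f u → G.Adj u p → ¬ G.Adj p q
  · exact h.of_left_leaves hxy hX hu
  by_cases hY : ∀ p q, p ≠ u' → q ≠ u' → f u < f p → f u < f q → G.Adj u p → ¬ G.Adj p q
  · refine h.neg.of_left_leaves ?_ ?_ hu
    · intro x y hx hy h1 h2 h3
      exact hxy y x hy hx (by omega) (by omega) h3.symm
    · intro p q hp hq h1 h2
      exact hY p q hp hq (by omega) (by omega)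
  push Not at hX hY
  obtain ⟨p, q, hp, hq, hpu, hqu, hup, hpq⟩ := hX
  obtain ⟨p', q', hp', hq', hpu', hqu', hup', hpq'⟩ := hY
  refine (not_rich_leaves h.loc h.ne hup hup' hpq hpq' ⟨hxy _ _ hp hp' hpu hpu',
    hxy _ _ hp hq' hpu hqu', hxy _ _ hq hp' hqu hpu', hxy _ _ hq hq' hqu hqu'⟩ ?_
    ⟨hp.symm, hp'.symm, hq.symm, hq'.symm⟩ hu).elim
  refine ⟨?_, ?_, ?_, ?_, ?_, ?_⟩ <;> rintro rfl <;> omega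

theorem of_left_clique (h : Inserting G f u u')
    (hxy : ∀ x y, x ≠ u' → y ≠ u' → f x < f u → f u < f y → (G.Adj x y ↔ G.Adj u x ∧ G.Adj u y))
    (hX : ∀ p q, p ≠ u' → q ≠ u' → f p < f u → f q < f u → p ≠ q → G.Adj u p →
      (G.Adj u q ↔ G.Adj p q))
    (hu : (¬ G.Adj u u' ∧ ∀ w, w ≠ u → w ≠ u' → (G.Adj u w ↔ G.Adj u' w)) ∨
      (G.Adj u u' ∧ ∀ w, w ≠ u → ¬ G.Adj u' w)) : ∃ g, OrdOn G Set.univ g := by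
  have hinj := h.inj'
  have hne := h.ne
  have hux : ∀ x, x ≠ u' → f x < f u → G.Adj u x := by
    intro x hx hxu
    by_contra hc
    have := h.closed (fun v => f v < f u ∧ ¬ G.Adj u v) (fun a b ha hb hab hP => by
      have := hinj b u hb hne
      have := hxy a b ha hb hP.1
      have := hX b a hb ha
      have := hab.ne
      grind [SimpleGraph.adj_comm]) hx ⟨hxu, hc⟩
    exact lt_irrefl _ this.1
  exact h.of_poor_clique hxy hux (fun x x' hx hx' h1 h2 h3 =>
    (hX x x' hx hx' h1 h2 h3 (hux x hx h1)).1 (hux x' hx' h2)) hu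

theorem exists_ordOn_of_both (h : Inserting G f u u') {x₀ y₀ : V} (hx₀ : x₀ ≠ u') (hy₀ : y₀ ≠ u')
    (hxu : f x₀ < f u) (huy : f u < f y₀) (hux : G.Adj u x₀) (huy' : G.Adj u y₀)
    {x₁ y₁ : V} (hx₁ : x₁ ≠ u') (hy₁ : y₁ ≠ u') (hxu₁ : f x₁ < f u) (huy₁ : f u < f y₁)
    (hxy₁ : G.Adj x₁ y₁)
    (hu : (∀ w, w ≠ u → w ≠ u' → (G.Adj u w ↔ G.Adj u' w)) ∨
      (G.Adj u u' ∧ ∀ w, w ≠ u → ¬ G.Adj u' w)) : ∃ g, OrdOn G Set.univ g := by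
  have hord := h.ord'
  have hne := h.ne
  have hxy : ∀ x y, x ≠ u' → y ≠ u' → f x < f u → f u < f y →
      (G.Adj x y ↔ G.Adj u x ∧ G.Adj u y) := by
    intro x y hx hy h1 h2
    refine ⟨fun e => ⟨(hord x x₀ y u hx hx₀ hy hne (by omega) h1 (by omega) hxu e hux.symm).symm,
      hord u x y₀ y hne hx hy₀ hy huy h2 (by omega) (by omega) huy' e⟩, fun ⟨e1, e2⟩ => ?_⟩
    have e3 := hord x x₁ u y₁ hx hx₁ hne hy₁ h1 (by omega) hxu₁ (by omega) e1.symm hxy₁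
    exact hord x u y₁ y hx hne hy₁ hy (by omega) (by omega) huy₁ h2 e3 e2
  by_cases hT : G.Adj u u' ∧ ∀ w, w ≠ u → w ≠ u' → (G.Adj u w ↔ G.Adj u' w)
  · exact h.of_twin (fun _ x y hx hy h1 h2 => (hxy x y hx hy h1 h2).1)
      (fun x y hx hy h1 h2 h3 h4 => ⟨(hxy x y hx hy h1 h2).2 ⟨h3, h4⟩, hT.1⟩) hT.2
  replace hu : (¬ G.Adj u u' ∧ ∀ w, w ≠ u → w ≠ u' → (G.Adj u w ↔ G.Adj u' w)) ∨
      (G.Adj u u' ∧ ∀ w, w ≠ u → ¬ G.Adj u' w) := by tauto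
  by_cases hX : ∀ p q, p ≠ u' → q ≠ u' → f p < f u → f q < f u → p ≠ q → G.Adj u p →
      (G.Adj u q ↔ G.Adj p q)
  · exact h.of_left_clique hxy hX hu
  by_cases hY : ∀ p q, p ≠ u' → q ≠ u' → f u < f p → f u < f q → p ≠ q → G.Adj u p →
      (G.Adj u q ↔ G.Adj p q)
  · refine h.neg.of_left_clique ?_ ?_ hu
    · intro x y hx hy h1 h2
      rw [G.adj_comm, hxy y x hy hx (by omega) (by omega), and_comm]
    · intro p q hp hq h1 h2
      exact hY p q hp hq (by omega) (by omega)
  push Not at hX hY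
  obtain ⟨p, q, hp, hq, hpu, hqu, hpq, hup, hX⟩ := hX
  obtain ⟨p', q', hp', hq', hpu', hqu', hpq', hup', hY⟩ := hY
  refine (not_rich_clique h.loc hne hpq hpq' hup hup' (by tauto) (by tauto)
    ((hxy _ _ hp hp' hpu hpu').2 ⟨hup, hup'⟩) ?_ ?_ (hxy _ _ hq hq' hqu hqu') ?_
    ⟨hp.symm, hp'.symm, hq.symm, hq'.symm⟩ hu).elim
  · rw [hxy _ _ hp hq' hpu hqu']
    tauto
  · rw [hxy _ _ hq hp' hqu hpu']
    tauto
  · refine ⟨?_, ?_, ?_, ?_, ?_⟩ <;> rintro rfl <;> omega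

theorem exists_ordOn_of_left (h : Inserting G f u u') {x₀ : V} (hx₀ : x₀ ≠ u')
    (hxu : f x₀ < f u) (hux : G.Adj u x₀) (huy : ∀ y, y ≠ u' → f u < f y → ¬ G.Adj u y)
    {x₁ y₁ : V} (hx₁ : x₁ ≠ u') (hy₁ : y₁ ≠ u') (hxu₁ : f x₁ < f u) (huy₁ : f u < f y₁)
    (hxy₁ : G.Adj x₁ y₁)
    (hu : (∀ w, w ≠ u → w ≠ u' → (G.Adj u w ↔ G.Adj u' w)) ∨
      (G.Adj u u' ∧ ∀ w, w ≠ u → ¬ G.Adj u' w)) : ∃ g, OrdOn G Set.univ g := by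
  have hord := h.ord'
  have hne := h.ne
  have hinj := h.inj'
  have hux₁ : G.Adj u x₁ :=
    (hord x₁ x₀ y₁ u hx₁ hx₀ hy₁ hne (by omega) hxu₁ (by omega) hxu hxy₁ hux.symm).symm
  have hxy : ∀ x y, x ≠ u' → y ≠ u' → f x < f u → f u < f y →
      (G.Adj x y ↔ G.Adj u x ∧ G.Adj x₁ y) := by
    intro x y hx hy h1 h2
    refine ⟨fun e => ⟨(hord x x₀ y u hx hx₀ hy hne (by omega) h1 (by omega) hxu e hux.symm).symm,
      hord x₁ x u y hx₁ hx hne hy hxu₁ (by omega) h1 (by omega) hux₁.symm e⟩, fun ⟨e1, e2⟩ => ?_⟩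
    exact hord x x₁ u y hx hx₁ hne hy h1 (by omega) hxu₁ (by omega) e1.symm e2
  by_cases huu : G.Adj u u'
  swap
  · rcases hu with hu | ⟨hu, -⟩
    · exact h.of_twin (fun h' => absurd h' huu)
        (fun x y hx hy h1 h2 h3 h4 => absurd h4 (huy y hy h2)) hu
    · exact absurd hu huu
  replace hu : (∀ w, w ≠ u → w ≠ u' → (G.Adj u w ↔ G.Adj u' w)) ∨
      (∀ w, w ≠ u → ¬ G.Adj u' w) := by tauto
  by_cases hY : ∀ y y', y ≠ u' → y' ≠ u' → f u < f y → f u < f y' → G.Adj x₁ y → ¬ G.Adj y y'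
  · have hy : ∀ y, y ≠ u' → f u < f y → G.Adj x₁ y := by
      intro y hy huy'
      by_contra hc
      have := h.closed (fun v => f u < f v ∧ ¬ G.Adj x₁ v) (fun a b ha hb hab hP => by
        have := hinj b u hb hne
        have := hxy b a hb ha
        have := hY b a hb ha
        have := huy a ha hP.1
        grind [SimpleGraph.adj_comm]) hy ⟨huy', hc⟩
      exact lt_irrefl _ this.1
    exact h.of_poor_independent huy (fun x y hx hy' h1 h2 => by
      rw [hxy x y hx hy' h1 h2, and_iff_left (hy y hy' h2)])
      (fun y y' hy' hy'' h1 h2 => hY y y' hy' hy'' h1 h2 (hy y hy' h1)) hu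
  push Not at hY
  obtain ⟨y, y', hy, hy', h1, h2, hxy', hyy⟩ := hY
  have hR1 : ∀ p, p ≠ u' → f p < f u → G.Adj u p → p = x₁ := by
    intro p hp hpu hup
    by_contra hpx
    refine not_rich_star (u' := u') h.loc hup hux₁ hpx ⟨?_, huy y hy h1⟩ ⟨?_, huy y' hy' h2⟩
      ((hxy p y hp hy hpu h1).2 ⟨hup, hxy'⟩) hxy' hyy ?_ ⟨?_, ?_⟩
      ⟨hp.symm, hx₁.symm, hy.symm, hy'.symm⟩ huu hu
    · rintro rfl; omega
    · rintro rfl; omega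
    · rw [hxy p y' hp hy' hpu h2, and_iff_right hup]
    · rintro rfl; omega
    · rintro rfl; omega
  have hR2 : ∀ q q', q ≠ u' → q' ≠ u' → f q < f u → f q' < f u → G.Adj x₁ q → x₁ ≠ q' →
      ¬ G.Adj q q' := by
    intro q q' hq hq' hqu hqu' hxq hxq' hqq
    have n1 : ¬ G.Adj u q := fun e => hxq.ne (hR1 q hq hqu e).symm
    have n2 : ¬ G.Adj u q' := fun e => hxq' (hR1 q' hq' hqu' e).symm
    refine not_rich_path (u' := u') h.loc hux₁ ⟨?_, n1⟩ ⟨?_, n2⟩ hxq hqq hxq'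
      ⟨?_, huy y hy h1⟩ ⟨?_, huy y' hy' h2⟩ hxy' ⟨?_, ?_, ?_, ?_⟩ hyy ?_
      ⟨hx₁.symm, hq.symm, hq'.symm, hy.symm, hy'.symm⟩ huu hu
    · rintro rfl; omega
    · rintro rfl; omega
    · rintro rfl; omega
    · rintro rfl; omega
    · rw [hxy q y hq hy hqu h1]; tauto
    · rw [hxy q y' hq hy' hqu h2]; tauto
    · rw [hxy q' y hq' hy hqu' h1]; tauto
    · rw [hxy q' y' hq' hy' hqu' h2]; tauto
    · refine ⟨?_, ?_, ?_, ?_, ?_⟩ <;> rintro rfl <;> omega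
  have hX : ∀ x, x ≠ u' → f x < f u → x ≠ x₁ → G.Adj x₁ x := by
    intro x hx hxu hxx
    by_contra hc
    have := h.closed (fun v => f v < f u ∧ v ≠ x₁ ∧ ¬ G.Adj x₁ v) (fun a b ha hb hab hP => by
      have := hinj b u hb hne
      have := hxy a b ha hb hP.1
      have := hR2 b a hb ha
      have := hR1 a ha
      grind [SimpleGraph.adj_comm]) hx ⟨hxu, hxx, hc⟩
    exact lt_irrefl _ this.1
  refine h.of_poor_star hx₁ hxu₁ hux₁ hR1 huy ?_ (fun x hx h1 h2 => (hX x hx h1 h2).symm) huu hu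
  intro x w hx hw h1 h2 h3
  have := hinj w u hw hne
  have := hxy x w hx hw h1
  have := hR2 x w hx hw h1
  have := hR1 x hx h1
  have := hX x hx h1 h2
  grind [SimpleGraph.adj_comm]

/-- An ordering extends to a new vertex that is a twin of, or pendant at, an old vertex. -/
theorem exists_ordOn (h : Inserting G f u u')
    (hu : (∀ w, w ≠ u → w ≠ u' → (G.Adj u w ↔ G.Adj u' w)) ∨
      (G.Adj u u' ∧ ∀ w, w ≠ u → ¬ G.Adj u' w)) : ∃ g, OrdOn G Set.univ g := by
  have hinj := h.inj'
  have hne := h.ne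
  by_cases hxy : ∀ x y, x ≠ u' → y ≠ u' → f x < f u → f u < f y → ¬ G.Adj x y
  · exact h.exists_ordOn_of_no_cross hxy hu
  push Not at hxy
  obtain ⟨x₁, y₁, hx₁, hy₁, hxu₁, huy₁, hxy₁⟩ := hxy
  by_cases hX : ∃ x, x ≠ u' ∧ f x < f u ∧ G.Adj u x <;>
    by_cases hY : ∃ y, y ≠ u' ∧ f u < f y ∧ G.Adj u y
  · obtain ⟨x, hx, h1, h2⟩ := hX
    obtain ⟨y, hy, h3, h4⟩ := hY
    exact h.exists_ordOn_of_both hx hy h1 h3 h2 h4 hx₁ hy₁ hxu₁ huy₁ hxy₁ hu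
  · obtain ⟨x, hx, h1, h2⟩ := hX
    push Not at hY
    exact h.exists_ordOn_of_left hx h1 h2 hY hx₁ hy₁ hxu₁ huy₁ hxy₁ hu
  · obtain ⟨y, hy, h1, h2⟩ := hY
    push Not at hX
    exact h.neg.exists_ordOn_of_left hy (by omega) h2 (fun x hx h => hX x hx (by omega)) hy₁ hx₁
      (by omega) (by omega) hxy₁.symm hu
  · push Not at hX hY
    have := h.closed (fun v => v ≠ u) (fun a b ha hb hab hP => by
      rintro rfl
      have := hinj a b ha hne
      have := hX a ha
      have := hY a ha
      grind [SimpleGraph.adj_comm]) hx₁ (by rintro rfl; omega)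
    exact absurd rfl this

end Inserting

end

theorem ConnOn.induce_connected {V : Type} {G : SimpleGraph V} {D : Set V} (hD : ConnOn G D)
    (hne : D.Nonempty) : (G.induce D).Connected := by
  have : Nonempty D := hne.to_subtype
  refine ⟨fun ⟨x, hx⟩ ⟨y, hy⟩ => ?_⟩
  have key : ∀ z, Relation.ReflTransGen (fun a b => G.Adj a b ∧ b ∈ D) x z →
      ∃ hz : z ∈ D, (G.induce D).Reachable ⟨x, hx⟩ ⟨z, hz⟩ := by
    intro z hz
    induction hz with
    | refl => exact ⟨hx, .refl _⟩
    | tail _ hab ih =>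
      obtain ⟨ha, hr⟩ := ih
      refine ⟨hab.2, hr.trans (SimpleGraph.Adj.reachable ?_)⟩
      exact hab.1
  exact (key y (hD x hx y hy)).2

theorem Loc.induce {V : Type} {G : SimpleGraph V} (hG : Loc G) (D : Set V) :
    Loc (G.induce D) := by
  intro s hs hcard
  obtain ⟨f, hf⟩ := hG (Subtype.val '' s) (hs.image _) ((Set.ncard_image_le hs).trans hcard)
  refine ⟨fun v => f v, fun a ha b hb hab => ?_, fun a ha b hb c hc d hd => ?_⟩
  · exact Subtype.ext (hf.1 ⟨a, ha, rfl⟩ ⟨b, hb, rfl⟩ hab)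
  · exact hf.2 a ⟨a, ha, rfl⟩ b ⟨b, hb, rfl⟩ c ⟨c, hc, rfl⟩ d ⟨d, hd, rfl⟩

theorem NoLongHole.induce {V : Type} {G : SimpleGraph V} (hG : NoLongHole G) (D : Set V) :
    NoLongHole (G.induce D) := by
  intro k f t hk hf
  refine hG k (fun i => f i) t hk ⟨fun i hi j hj => hf.adj_iff i hi j hj, ?_⟩
  intro i hi j hj hij
  exact hf.inj i hi j hj (Subtype.ext hij)

theorem ConnOn.remove_twin_or_pendant {V : Type} {G : SimpleGraph V} (hconn : G.Connected)
    {u u' : V} (hne : u ≠ u') (hu : (∀ w, w ≠ u → w ≠ u' → (G.Adj u w ↔ G.Adj u' w)) ∨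
      (G.Adj u u' ∧ ∀ w, w ≠ u → ¬ G.Adj u' w)) : ConnOn G {v | v ≠ u'} := by
  intro x hx y hy
  have := Relation.ReflTransGen.lift' (fun v => if v = u' then u else v)
    (p := fun a b => G.Adj a b ∧ b ∈ {v | v ≠ u'}) (fun a b (hab : G.Adj a b ∧ b ∈ Set.univ) => ?_)
    _ _ (connOn_univ hconn x trivial y trivial)
  · simpa only [Function.onFun, if_neg (show x ≠ u' from hx), if_neg (show y ≠ u' from hy)] using this
  · have h1 := hab.1
    have h2 := hab.1.ne
    by_cases h : (if a = u' then u else a) = (if b = u' then u else b)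
    · simp only [Function.onFun, h]
      exact .refl
    · refine .single ⟨?_, ?_⟩
      · grind [SimpleGraph.adj_comm]
      · grind

theorem exists_ordOn_univ {V : Type} [Finite V] {G : SimpleGraph V} (hG : Loc G)
    (hN : NoLongHole G) (hconn : G.Connected) : ∃ f, OrdOn G Set.univ f := by
  induction hn : Nat.card V using Nat.strong_induction_on generalizing V with
  | _ n ih =>
    rcases subsingleton_or_nontrivial V with hV | hV
    · refine ⟨0, fun a _ b _ _ => Subsingleton.elim a b, fun a _ b _ c _ d _ hac => ?_⟩
      simp at hac
    obtain ⟨u, u', hne, hu⟩ := exists_twins_or_pendant hG hN hconn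
    have hD := ConnOn.remove_twin_or_pendant hconn hne hu
    have hcard : Nat.card {v | v ≠ u'} < n := by
      rw [← hn]
      exact Finite.card_subtype_lt (p := fun v => v ≠ u') (x := u') (by simp)
    obtain ⟨f, hf⟩ := ih _ hcard (hG.induce _) (hN.induce _) (hD.induce_connected ⟨u, hne⟩) rfl
    refine Inserting.exists_ordOn (f := fun v => if hv : v ≠ u' then f ⟨v, hv⟩ else 0)
      ⟨hne, hG, ⟨?_, ?_⟩, hD⟩ hu
    · intro a ha b hb hab
      have ha' : a ≠ u' := ha
      have hb' : b ≠ u' := hb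
      simp only [ha', hb', ne_eq, not_false_eq_true, dite_true] at hab
      exact congrArg Subtype.val (hf.1 trivial trivial hab)
    · intro a ha b hb c hc d hd
      have ha' : a ≠ u' := ha
      have hb' : b ≠ u' := hb
      have hc' : c ≠ u' := hc
      have hd' : d ≠ u' := hd
      simp only [ha', hb', hc', hd', ne_eq, not_false_eq_true, dite_true]
      exact hf.2 ⟨a, ha⟩ trivial ⟨b, hb⟩ trivial ⟨c, hc⟩ trivial ⟨d, hd⟩ trivial

section

theorem zmod_val_add_one_eq_ite {n : ℕ} (hn : 1 ≤ n) (i : ZMod (n + 1)) :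
    (i + 1).val = if i.val = n then 0 else i.val + 1 := by
  have h1 := ZMod.val_lt i
  rw [ZMod.val_add, ZMod.val_one'' (by omega)]
  split_ifs with h
  · rw [h, Nat.mod_self]
  · exact Nat.mod_eq_of_lt (by omega)

theorem IsLongHole.of_nat {V : Type} {G : SimpleGraph V} {n : ℕ} (hn : 8 ≤ n) {q : ℕ → V}
    (inj : ∀ i ≤ n, ∀ j ≤ n, q i = q j → i = j)
    (adj_iff : ∀ i ≤ n, ∀ j ≤ n, G.Adj (q i) (q j) ↔
      j = i + 1 ∨ i = j + 1 ∨ (i = n ∧ j = 0) ∨ (j = n ∧ i = 0)) :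
    IsLongHole G 1 (fun i : ZMod (n + 1) => q i.val) := by
  refine .zmod (by omega) ?_ ?_
  · intro i j hij
    have hi := ZMod.val_lt i
    have hj := ZMod.val_lt j
    exact ZMod.val_injective _ (inj _ (by omega) _ (by omega) hij)
  · intro i j
    have hi := ZMod.val_lt i
    have hj := ZMod.val_lt j
    rw [adj_iff _ (by omega) _ (by omega), ← (ZMod.val_injective (n + 1)).eq_iff,
      ← (ZMod.val_injective (n + 1)).eq_iff, zmod_val_add_one_eq_ite (by omega),
      zmod_val_add_one_eq_ite (by omega)]
    split_ifs <;> omega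

/-- The graph obtained from `G` by joining `y` to `x` by a path with nine new vertices. -/
def closeUp {V : Type} (G : SimpleGraph V) (x y : V) : SimpleGraph (V ⊕ Fin 9) where
  Adj
    | .inl a, .inl b => G.Adj a b
    | .inl a, .inr j => (a = y ∧ j = 0) ∨ (a = x ∧ j = 8)
    | .inr i, .inl b => (b = y ∧ i = 0) ∨ (b = x ∧ i = 8)
    | .inr i, .inr j => i.val + 1 = j.val ∨ j.val + 1 = i.val
  symm := ⟨by
    rintro (a | i) (b | j) h
    · exact SimpleGraph.Adj.symm (G := G) h
    · exact h
    · exact h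
    · exact h.symm⟩
  loopless := ⟨by
    rintro (a | i) h
    · exact G.irrefl h
    · rcases h with h | h <;> omega⟩

section closeUp

variable {V : Type} {G : SimpleGraph V} {x y : V}

@[simp] theorem closeUp_inl_inl {a b : V} :
    (closeUp G x y).Adj (.inl a) (.inl b) ↔ G.Adj a b := Iff.rfl

@[simp] theorem closeUp_inl_inr {a : V} {j : Fin 9} :
    (closeUp G x y).Adj (.inl a) (.inr j) ↔ (a = y ∧ j = 0) ∨ (a = x ∧ j = 8) := Iff.rfl

@[simp] theorem closeUp_inr_inl {b : V} {i : Fin 9} :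
    (closeUp G x y).Adj (.inr i) (.inl b) ↔ (b = y ∧ i = 0) ∨ (b = x ∧ i = 8) := Iff.rfl

@[simp] theorem closeUp_inr_inr {i j : Fin 9} :
    (closeUp G x y).Adj (.inr i) (.inr j) ↔ i.val + 1 = j.val ∨ j.val + 1 = i.val := Iff.rfl

theorem closeUp_connected (hG : G.Connected) (x y : V) : (closeUp G x y).Connected := by
  let φ : G →g closeUp G x y := ⟨Sum.inl, fun h => h⟩
  have h1 : ∀ n (hn : n < 9), (closeUp G x y).Reachable (.inl y) (.inr ⟨n, hn⟩) := by
    intro n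
    induction n with
    | zero => exact fun _ => SimpleGraph.Adj.reachable (Or.inl ⟨rfl, rfl⟩)
    | succ n ih => exact fun hn => (ih (by omega)).trans (SimpleGraph.Adj.reachable (Or.inl rfl))
  have h2 : ∀ w, (closeUp G x y).Reachable (.inl y) w := by
    rintro (a | i)
    · exact (hG.preconnected y a).map φ
    · exact h1 i.val i.isLt
  have : Nonempty (V ⊕ Fin 9) := ⟨.inl y⟩
  exact ⟨fun a b => (h2 a).symm.trans (h2 b)⟩

theorem closeUp_loc {f : V → ℤ} (hf : OrdOn G Set.univ f) (hx : ∀ v, f x ≤ f v)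
    (hy : ∀ v, f v ≤ f y) : Loc (closeUp G x y) := by
  intro s hs hcard
  have hj : ∃ j : Fin 9, (.inr j : V ⊕ Fin 9) ∉ s := by
    by_contra! hc
    have h1 : (Set.range (Sum.inr : Fin 9 → V ⊕ Fin 9)).ncard ≤ s.ncard :=
      Set.ncard_le_ncard (Set.range_subset_iff.2 hc) hs
    rw [Set.ncard_range_of_injective Sum.inr_injective, Nat.card_fin] at h1
    omega
  obtain ⟨j, hj⟩ := hj
  let g : V ⊕ Fin 9 → ℤ := Sum.elim f
    (fun i => if j < i then f x - 9 + i.val else f y + 1 + i.val)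
  have hgl : ∀ v, g (.inl v) = f v := fun v => rfl
  have hgr : ∀ i : Fin 9, (j.val < i.val ∧ g (.inr i) = f x - 9 + i.val) ∨
      (i.val ≤ j.val ∧ g (.inr i) = f y + 1 + i.val) := by
    intro i
    by_cases h : j < i
    · exact Or.inl ⟨h, if_pos h⟩
    · exact Or.inr ⟨not_lt.1 h, if_neg h⟩
  have hinj : Function.Injective g := by
    rintro (a | i) (b | i') hab
    · exact congrArg Sum.inl (hf.1 trivial trivial hab)
    · have := hgr i'
      have := hgl a
      have := hx a
      have := hy a
      omega
    · have := hgr i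
      have := hgl b
      have := hx b
      have := hy b
      omega
    · have := hgr i
      have := hgr i'
      have := hx y
      exact congrArg Sum.inr (Fin.ext (by omega))
  have hcons : ∀ a ∈ s, ∀ c ∈ s, g a < g c → (closeUp G x y).Adj a c →
      (∃ a' c', a = .inl a' ∧ c = .inl c') ∨ g c = g a + 1 := by
    have h0 : (0 : Fin 9).val = 0 := rfl
    have h8 : (8 : Fin 9).val = 8 := rfl
    have hne : ∀ i, (.inr i : V ⊕ Fin 9) ∈ s → i.val ≠ j.val :=
      fun i hi h => hj (Fin.ext h ▸ hi)
    rintro (a | i) ha (c | i') hc hlt hac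
    · exact Or.inl ⟨a, c, rfl, rfl⟩
    · have := hgr i'
      have := hgl a
      have := hx a
      have := hne i' hc
      rcases hac with ⟨rfl, rfl⟩ | ⟨rfl, rfl⟩ <;> omega
    · have := hgr i
      have := hgl c
      have := hy c
      have := hne i ha
      rcases hac with ⟨rfl, rfl⟩ | ⟨rfl, rfl⟩ <;> omega
    · have := hgr i
      have := hgr i'
      have := hne i ha
      have := hne i' hc
      have := hx y
      rcases hac with h | h <;> omega
  have hconv : ∀ p q w, f p ≤ g w → g w ≤ f q → ∃ w', w = .inl w' := by
    rintro p q (w | i) h1 h2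
    · exact ⟨w, rfl⟩
    · have := hgr i
      have := hx p
      have := hy q
      omega
  refine ⟨g, hinj.injOn, ?_⟩
  intro a ha b hb c hc d hd hac had hbc hbd h1 h2
  rcases hcons a ha c hc hac h1 with ⟨a', c', rfl, rfl⟩ | h3 <;>
    rcases hcons b hb d hd hbd h2 with ⟨b', d', rfl, rfl⟩ | h4
  · exact hf.2 a' trivial b' trivial c' trivial d' trivial hac had hbc hbd h1 h2
  · simp only [hgl] at *
    obtain ⟨b', rfl⟩ := hconv a' c' b (by omega) (by omega)
    obtain ⟨d', rfl⟩ := hconv a' c' d (by omega) (by omega)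
    exact hf.2 a' trivial b' trivial c' trivial d' trivial hac had hbc hbd h1 h2
  · simp only [hgl] at *
    obtain ⟨a', rfl⟩ := hconv b' d' a (by omega) (by omega)
    obtain ⟨c', rfl⟩ := hconv b' d' c (by omega) (by omega)
    exact hf.2 a' trivial b' trivial c' trivial d' trivial hac had hbc hbd h1 h2
  · rwa [hinj (show g d = g c by omega)]

end closeUp

end

section

theorem IsThreadBlock.comap {V W : Type} {G : SimpleGraph V} {H : SimpleGraph W} (φ : G ↪g H)
    {B : Finset V} {B' : Finset W} {x y : V} (hB : IsThreadBlock H B' (φ x) (φ y))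
    (h : B' = B.map φ.toEmbedding) : IsThreadBlock G B x y := by
  subst h
  obtain ⟨h2, hx, hy, σ, lL, lR, h3, h4, h5, h6, h7, h8, h9, h10⟩ := hB
  have hmem : ∀ {v}, v ∈ B → φ v ∈ B.map φ.toEmbedding :=
    fun hv => Finset.mem_map_of_mem φ.toEmbedding hv
  have hmem' : ∀ {v}, φ v ∈ B.map φ.toEmbedding → v ∈ B := by
    intro v hv
    exact (Finset.mem_map' φ.toEmbedding).1 hv
  let e : ↥B ≃ ↥(B.map φ.toEmbedding) := Equiv.ofBijective (fun v => ⟨φ v.1, hmem v.2⟩) <| by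
    refine ⟨fun a b hab => ?_, ?_⟩
    · exact Subtype.ext (φ.injective (congrArg Subtype.val hab))
    · rintro ⟨w, hw⟩
      obtain ⟨v, hv, rfl⟩ := Finset.mem_map.1 hw
      exact ⟨⟨v, hv⟩, rfl⟩
  have hcard : (B.map φ.toEmbedding).card = B.card := Finset.card_map _
  refine ⟨hcard ▸ h2, hmem' hx, hmem' hy, (e.trans σ).trans (finCongr hcard), fun v => lL (φ v),
    fun v => lR (φ v), fun v => h3 (e v), fun _ => h4 _, h5, h6, ?_, h8, h9, ?_⟩
  · intro hy'
    exact (h7 hy).trans (by rw [hcard])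
  · intro v w hvw
    exact φ.map_rel_iff.symm.trans (h10 (e v) (e w) hvw)

variable {V : Type} {G : SimpleGraph V} {p : ℕ → V} {k : ℕ}

/-- The path `p 0, …, p k` followed by the nine new vertices of `closeUp G (p 0) (p k)`. -/
def closeUpCycle (p : ℕ → V) (k i : ℕ) : V ⊕ Fin 9 :=
  if i ≤ k then .inl (p i) else .inr (Fin.ofNat 9 (i - (k + 1)))

theorem closeUpCycle_of_le {i : ℕ} (hi : i ≤ k) : closeUpCycle p k i = .inl (p i) := if_pos hi

theorem closeUpCycle_of_lt {i : ℕ} (hi : k < i) :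
    closeUpCycle p k i = .inr (Fin.ofNat 9 (i - (k + 1))) := if_neg (by omega)

theorem isLongHole_closeUpCycle (hp : IsIndPath G k p) (hk : 1 ≤ k) :
    IsLongHole (closeUp G (p 0) (p k)) 1
      (fun i : ZMod (k + 9 + 1) => closeUpCycle p k i.val) := by
  have h8 : ((8 : Fin 9) : ℕ) = 8 := rfl
  have h0 : ((0 : Fin 9) : ℕ) = 0 := rfl
  refine .of_nat (by omega) ?_ ?_
  · intro i hi j hj hij
    rcases le_or_gt i k with h1 | h1 <;> rcases le_or_gt j k with h2 | h2
    · rw [closeUpCycle_of_le h1, closeUpCycle_of_le h2] at hij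
      exact hp.inj i h1 j h2 (Sum.inl_injective hij)
    · rw [closeUpCycle_of_le h1, closeUpCycle_of_lt h2] at hij
      cases hij
    · rw [closeUpCycle_of_lt h1, closeUpCycle_of_le h2] at hij
      cases hij
    · rw [closeUpCycle_of_lt h1, closeUpCycle_of_lt h2] at hij
      have := congrArg Fin.val (Sum.inr_injective hij)
      simp only [Fin.val_ofNat] at this
      omega
  · intro i hi j hj
    have hend : ∀ i ≤ k, (p i = p k ↔ i = k) ∧ (p i = p 0 ↔ i = 0) := fun i hi =>
      ⟨⟨hp.inj i hi k le_rfl, congrArg p⟩, ⟨hp.inj i hi 0 (by omega), congrArg p⟩⟩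
    rcases le_or_gt i k with h1 | h1 <;> rcases le_or_gt j k with h2 | h2
    · rw [closeUpCycle_of_le h1, closeUpCycle_of_le h2, closeUp_inl_inl, hp.adj_iff i h1 j h2]
      omega
    · rw [closeUpCycle_of_le h1, closeUpCycle_of_lt h2, closeUp_inl_inr, (hend i h1).1,
        (hend i h1).2, Fin.ext_iff, Fin.ext_iff, Fin.val_ofNat]
      omega
    · rw [closeUpCycle_of_lt h1, closeUpCycle_of_le h2, closeUp_inr_inl, (hend j h2).1,
        (hend j h2).2, Fin.ext_iff, Fin.ext_iff, Fin.val_ofNat]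
      omega
    · rw [closeUpCycle_of_lt h1, closeUpCycle_of_lt h2, closeUp_inr_inr, Fin.val_ofNat,
        Fin.val_ofNat]
      omega

theorem val_natCast_of_le {n m : ℕ} (h : m ≤ n) : ((m : ℕ) : ZMod (n + 1)).val = m :=
  ZMod.val_natCast_of_lt (by omega)

/-- Beyond the path, the blocks of `closeUp G (p 0) (p k)` contain only cycle vertices. -/
theorem exists_eq_of_mem_holeBlock_closeUp (hk : 1 ≤ k) {i : ZMod (k + 9 + 1)} (hi : k ≤ i.val)
    {w : V ⊕ Fin 9} (hw : w ∈ holeBlock (closeUp G (p 0) (p k)) 1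
      (fun i : ZMod (k + 9 + 1) => closeUpCycle p k i.val) (fun i => i.val = k) i) :
    ∃ j : ZMod (k + 9 + 1), closeUpCycle p k j.val = w := by
  by_contra! hc
  have hi' := ZMod.val_lt i
  have hs := zmod_val_add_one_eq_ite (n := k + 9) (by omega) i
  have hno : ∀ t, (∀ j : ZMod (k + 9 + 1), closeUpCycle p k j.val ≠ t) →
      ∀ j : ZMod (k + 9 + 1), k < j.val →
        ¬ (closeUp G (p 0) (p k)).Adj (closeUpCycle p k j.val) t := by
    rintro (v | m) ht j hj
    · rw [closeUpCycle_of_lt hj, closeUp_inr_inl]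
      rintro (⟨rfl, -⟩ | ⟨rfl, -⟩)
      · have := ht (k : ℕ)
        rw [val_natCast_of_le (by omega), closeUpCycle_of_le le_rfl] at this
        exact this rfl
      · have := ht (0 : ℕ)
        rw [val_natCast_of_le (by omega), closeUpCycle_of_le (by omega)] at this
        exact this rfl
    · have := ht (k + 1 + m.val : ℕ)
      rw [val_natCast_of_le (by omega), closeUpCycle_of_lt (by omega)] at this
      refine absurd (congrArg Sum.inr (Fin.ext ?_)) this
      rw [Fin.val_ofNat]
      omega
  rcases hw with rfl | rfl | ⟨-, hj, ⟨j, hadj⟩, hA, hB⟩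
  · exact hc _ rfl
  · exact hc _ rfl
  have hjk : j.val ≤ k := not_lt.1 fun h => hno w hc j h hadj
  rcases hj j hadj with rfl | rfl
  · rw [if_neg (by omega)] at hs
    rcases hA hadj with h | h
    · exact hno w hc _ (by omega) h
    · refine h (Or.inr ⟨by omega, ?_⟩)
      rintro ⟨t, ht, -, h⟩
      exact hno t ht _ (by omega) h
  · have hik : i.val = k + 9 := by
      by_contra h
      rw [if_neg h] at hs
      omega
    rw [if_pos hik] at hs
    rcases hB hadj with h | ⟨t, ht, -, h⟩ | ⟨h, -⟩
    · exact hno w hc _ (by omega) h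
    · rw [add_sub_cancel_right] at h
      exact hno t ht _ (by omega) h
    · omega

theorem isThreadGraph_of_ordOn [Fintype V] (hG : G.Connected) {f : V → ℤ}
    (hf : OrdOn G Set.univ f) : IsThreadGraph G := by
  refine ⟨hG, or_iff_not_imp_left.2 fun hcard => ?_⟩
  have hV : Nontrivial V := Fintype.one_lt_card_iff_nontrivial.1 (by omega)
  obtain ⟨x, hx⟩ := Finite.exists_min f
  obtain ⟨y, hy⟩ := Finite.exists_max f
  have hxy : x ≠ y := by
    rintro rfl
    obtain ⟨z, hz⟩ := exists_ne x
    exact hz (hf.1 trivial trivial (le_antisymm (hy z) (hx z)))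
  obtain ⟨k, p, hp, rfl, rfl, -⟩ := (connOn_univ hG).exists_indPath (X := {x}) (Y := {y})
    (Set.subset_univ _) (Set.subset_univ _) (Set.singleton_nonempty _) (Set.singleton_nonempty _)
  have hk : 1 ≤ k := by
    by_contra h
    obtain rfl : k = 0 := by omega
    exact hxy rfl
  have hc := isLongHole_closeUpCycle hp hk
  have hloc := closeUp_loc hf hx hy
  have hconn := closeUp_connected hG (p 0) (p k)
  let c : ZMod (k + 9 + 1) → V ⊕ Fin 9 := fun i => closeUpCycle p k i.val
  let C : ZMod (k + 9 + 1) → Set (V ⊕ Fin 9) :=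
    holeBlock (closeUp G (p 0) (p k)) 1 c (fun i => i.val = k)
  have hcp : ∀ i : ℕ, i ≤ k → c (i : ℕ) = .inl (p i) := by
    intro i hi
    simp only [c]
    rw [val_natCast_of_le (by omega), closeUpCycle_of_le hi]
  have hcp' : ∀ i : ℕ, i + 1 ≤ k → c ((i : ℕ) + 1) = .inl (p (i + 1)) := by
    intro i hi
    rw [← hcp (i + 1) hi, Nat.cast_succ]
  have hinl : ∀ i : ℕ, i < k → ∀ w ∈ C (i : ℕ), ∃ v, w = .inl v := by
    rintro i hi (v | m) hw
    · exact ⟨v, rfl⟩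
    · rcases hw with h | h | ⟨h, -⟩
      · rw [hcp i hi.le] at h
        cases h
      · rw [hcp' i hi] at h
        cases h
      · have := h (k + 1 + m.val : ℕ)
        simp only [c] at this
        rw [val_natCast_of_le (by omega), closeUpCycle_of_lt (by omega)] at this
        refine absurd (congrArg Sum.inr (Fin.ext ?_)) this
        rw [Fin.val_ofNat]
        omega
  have hbig : ∀ i : ZMod (k + 9 + 1), k ≤ i.val → ∀ v, .inl v ∈ C i → ∃ j ≤ k, v = p j := by
    intro i hi v hv
    obtain ⟨j, hj⟩ := exists_eq_of_mem_holeBlock_closeUp hk hi hv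
    have hjk : j.val ≤ k := by
      by_contra h
      rw [closeUpCycle_of_lt (by omega)] at hj
      cases hj
    rw [closeUpCycle_of_le hjk] at hj
    exact ⟨j.val, hjk, (Sum.inl_injective hj).symm⟩
  have hleft : ∀ i : ℕ, i < k → .inl (p i) ∈ C (i : ℕ) := fun i hi => Or.inl (hcp i hi.le).symm
  have hright : ∀ i : ℕ, i < k → .inl (p (i + 1)) ∈ C (i : ℕ) :=
    fun i hi => Or.inr (Or.inl (hcp' i hi).symm)
  let φ : G ↪g closeUp G (p 0) (p k) := ⟨⟨Sum.inl, Sum.inl_injective⟩, Iff.rfl⟩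
  refine ⟨k, fun i => p i, fun i => (Sum.inl ⁻¹' C (i : ℕ)).toFinset, hk, ?_, ?_, ?_, ?_, ?_⟩
  · intro i j hij
    exact Fin.ext (hp.inj _ (by omega) _ (by omega) hij)
  · intro i
    have h : IsThreadBlock (closeUp G (p 0) (p k)) (C (i : ℕ)).toFinset (c (i : ℕ))
      (c ((i : ℕ) + 1)) := hc.isThreadBlock hloc (fun i => i.val = k) (i : ℕ)
    rw [hcp _ i.isLt.le, hcp' _ i.isLt] at h
    refine h.comap φ ?_
    ext w
    simp only [Set.mem_toFinset, Finset.mem_map, Set.mem_preimage]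
    constructor
    · intro hw
      obtain ⟨v, rfl⟩ := hinl i i.isLt w hw
      exact ⟨v, hw, rfl⟩
    · rintro ⟨v, hv, rfl⟩
      exact hv
  · intro i j hij
    have hij' : ((i : ℕ) : ZMod (k + 9 + 1)) ≠ (j : ℕ) := by
      intro h
      have := congrArg ZMod.val h
      rw [val_natCast_of_le (by omega), val_natCast_of_le (by omega)] at this
      exact hij (Fin.ext this)
    have h : C (i : ℕ) ∩ C (j : ℕ) = ({c (i : ℕ), c ((i : ℕ) + 1)} : Set _) ∩
      {c (j : ℕ), c ((j : ℕ) + 1)} := hc.holeBlock_inter (fun i => i.val = k) hij'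
    rw [hcp _ i.isLt.le, hcp' _ i.isLt, hcp _ j.isLt.le, hcp' _ j.isLt] at h
    ext v
    change _ ↔ _ ∈ ({p i, p (i + 1)} : Set V) ∩ {p j, p (j + 1)}
    simpa only [Set.coe_toFinset, Set.mem_inter_iff, Set.mem_preimage, Set.mem_insert_iff,
      Set.mem_singleton_iff, Sum.inl.injEq] using Set.ext_iff.1 h (.inl v)
  · intro a
    simp only [Set.mem_toFinset, Set.mem_preimage]
    obtain ⟨i, hi⟩ := hc.exists_mem_holeBlock hloc hconn (fun i => i.val = k) (.inl a)
    rcases lt_or_ge i.val k with hik | hik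
    · refine ⟨⟨i.val, hik⟩, ?_⟩
      rw [ZMod.natCast_zmod_val]
      exact hi
    · obtain ⟨j, hj, rfl⟩ := hbig i hik a hi
      rcases hj.lt_or_eq with hj | rfl
      · exact ⟨⟨j, hj⟩, hleft j hj⟩
      · refine ⟨⟨j - 1, by omega⟩, ?_⟩
        have := hright (j - 1) (by omega)
        rwa [Nat.sub_add_cancel hk] at this
  · intro a b hab
    simp only [Set.mem_toFinset, Set.mem_preimage]
    obtain ⟨i, hia, hib⟩ := hc.exists_mem_holeBlock_of_adj hloc hconn (fun i => i.val = k)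
      (u := .inl a) (v := .inl b) hab
    rcases lt_or_ge i.val k with hik | hik
    · refine ⟨⟨i.val, hik⟩, ?_⟩
      rw [ZMod.natCast_zmod_val]
      exact ⟨hia, hib⟩
    · obtain ⟨j, hj, rfl⟩ := hbig i hik a hia
      obtain ⟨j', hj', rfl⟩ := hbig i hik b hib
      rcases (hp.adj_iff j hj j' hj').1 hab with rfl | rfl
      · exact ⟨⟨j, by omega⟩, hleft j (by omega), hright j (by omega)⟩
      · exact ⟨⟨j', by omega⟩, hright j' (by omega), hleft j' (by omega)⟩

end

theorem IsIndPath.isLongHole {V : Type} {G : SimpleGraph V} {k : ℕ} {f : ℕ → V} {t : V}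
    (hf : IsIndPath G k f) (hk : 7 ≤ k) (ht : ∀ i ≤ k, G.Adj t (f i) ↔ i = 0 ∨ i = k) :
    IsLongHole G 1 (fun i : ZMod (k + 1 + 1) => if i.val ≤ k then f i.val else t) := by
  have hft : ∀ i ≤ k, f i ≠ t := by
    rintro i hi rfl
    have h1 := (ht i hi).not.1 G.irrefl
    have h2 := (ht (i + 1) (by omega)).1 ((hf.adj_iff i hi (i + 1) (by omega)).2 (by omega))
    have h3 := (ht (i - 1) (by omega)).1 ((hf.adj_iff i hi (i - 1) (by omega)).2 (by omega))
    omega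
  refine .of_nat (q := fun i => if i ≤ k then f i else t) (by omega) ?_ ?_
  · intro i hi j hj hij
    split_ifs at hij with h1 h2 h2
    · exact hf.inj i h1 j h2 hij
    · exact absurd hij (hft i h1)
    · exact absurd hij.symm (hft j h2)
    · omega
  · intro i hi j hj
    split_ifs with h1 h2 h2
    · rw [hf.adj_iff i h1 j h2]
      omega
    · rw [G.adj_comm, ht i h1]
      omega
    · rw [ht j h2]
      omega
    · simp only [SimpleGraph.irrefl, false_iff]
      omega

theorem isThreadGraph_or_isNecklaceDecomp {V : Type} [Fintype V] {G : SimpleGraph V}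
    (hconn : G.Connected) (hG : Loc G) :
    IsThreadGraph G ∨ ∃ (h : ℕ) (v : Fin h → V) (B : Fin h → Finset V),
      9 ≤ h ∧ IsNecklaceDecomp G h v B := by
  by_cases hN : NoLongHole G
  · obtain ⟨f, hf⟩ := exists_ordOn_univ hG hN hconn
    exact Or.inl (isThreadGraph_of_ordOn hconn hf)
  · unfold NoLongHole at hN
    push Not at hN
    obtain ⟨k, f, t, hk, hf, ht⟩ := hN
    obtain ⟨v, B, h⟩ := isNecklaceDecomp_of_hole hG hconn (by omega) (hf.isLongHole hk ht)
    exact Or.inr ⟨k + 1 + 1, v, B, by omega, h⟩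

theorem loc_of_forall_linRankwidthLE {V : Type} [Fintype V] {G : SimpleGraph V}
    (h : ∀ s : Set V, s.ncard ≤ 8 → LinRankwidthLE (G.induce s) 1) : Loc G :=
  fun s _ hcard => exists_ordOn_of_linRankwidthLE G s (h s hcard)

/-- every connected Ω_N-free graph (i.e. every induced subgraph on at most 8
vertices has linear rankwidth at most 1; all members of Ω_N have at most 8 vertices and
this is equivalent to excluding them as induced subgraphs) is a thread graph or a
necklace graph whose underlying cycle has length at least 9. -/
theorem stmt4 {V : Type} [Fintype V] (G : SimpleGraph V) (hconn : G.Connected)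
    (hfree : ∀ s : Set V, s.ncard ≤ 8 → LinRankwidthLE (G.induce s) 1) :
    IsThreadGraph G ∨
      ∃ (h : ℕ) (v : Fin h → V) (B : Fin h → Finset V),
        9 ≤ h ∧ IsNecklaceDecomp G h v B := by
  exact isThreadGraph_or_isNecklaceDecomp hconn (loc_of_forall_linRankwidthLE hfree)

end LRW1
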